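/- arXiv:2305.08716 — 5 statements merged into one kernel-verified Lean document; each statement's English description precedes it below -/
import Mathlib

section
/- Let 4 ≤ n ≤ 10 and let S = ∂(σ₁,…,σ_{n−3}) be a linear stacked 2-sphere on n vertices (the dual graph being a path in this order). Then there exist transversals T₁ and T₂ of S, each of size at most ⌊n/2⌋, such that T₁ ∪ T₂ contains at least 3 vertices of σ_{n−3}. -/
open Finset

/-- `τ` is a face of the partial stacked ball built from the first `k` simplices of `σ`. -/
def memBall {m : ℕ} (σ : Fin m → Finset ℕ) (k : ℕ) (τ : Finset ℕ) : Prop :=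
  ∃ i : Fin m, i.val < k ∧ τ ⊆ σ i

/-- `σ` is a construction sequence `Γ(B) = (σ₁, …, σ_m)` of a stacked `(d+1)`-ball `B`:
each `σ i` is a `(d+2)`-element vertex set (a `(d+1)`-simplex), and each `σ k` (`k > 0`)
is glued to the previously built ball `B_k` along a `(d+1)`-element free face `η` of
`B_k` (a face lying in a unique maximal face), i.e. `B_k ∩ 2^{σ k} = 2^η`. -/
def IsStackedBall (d m : ℕ) (σ : Fin m → Finset ℕ) : Prop :=
  (∀ i : Fin m, (σ i).card = d + 2) ∧
  ∀ k : Fin m, 0 < k.val →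
    ∃ η : Finset ℕ, η.card = d + 1 ∧ η ⊆ σ k ∧
      (∃! i : Fin m, i.val < k.val ∧ η ⊆ σ i) ∧
      (∀ τ : Finset ℕ, τ ⊆ σ k → (memBall σ k.val τ ↔ τ ⊆ η))

/-- The facets of the stacked `d`-sphere `S = ∂(σ₁,…,σ_m)`: the `(d+1)`-element free
faces of the stacked `(d+1)`-ball, i.e. the `(d+1)`-element sets contained in a unique
simplex `σ i`. -/
def sphereFacets (d m : ℕ) (σ : Fin m → Finset ℕ) : Set (Finset ℕ) :=
  {f | f.card = d + 1 ∧ ∃! i : Fin m, f ⊆ σ i}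

/-- The vertex set of the stacked ball `∂(σ₁,…,σ_m)` and of its boundary sphere. -/
def vertexSet (m : ℕ) (σ : Fin m → Finset ℕ) : Finset ℕ :=
  Finset.univ.biUnion σ

/-- `T` is a transversal of the hypergraph `H`: it meets every edge of `H`. -/
def IsTransversal (T : Finset ℕ) (H : Set (Finset ℕ)) : Prop :=
  ∀ e ∈ H, (T ∩ e).Nonempty

/-- The transversal number `τ(H)` of a hypergraph `H`: the minimum size of a transversal. -/
noncomputable def tau (H : Set (Finset ℕ)) : ℕ :=
  sInf {n | ∃ T : Finset ℕ, T.card = n ∧ IsTransversal T H}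

/-- Adjacency in the dual graph `G(B)`: `i ≠ j` and `σ i ∩ σ j` is a `d`-simplex. -/
def DualAdj (d m : ℕ) (σ : Fin m → Finset ℕ) (i j : Fin m) : Prop :=
  i ≠ j ∧ (σ i ∩ σ j).card = d + 1

/-- The dual graph `G(B)` is the path `1 – 2 – ⋯ – m` in this index order. -/
def IsPathOrder (d m : ℕ) (σ : Fin m → Finset ℕ) : Prop :=
  ∀ i j : Fin m, DualAdj d m σ i j ↔ (i.val + 1 = j.val ∨ j.val + 1 = i.val)

/-- The stacked sphere is linear: its dual graph `G(B)` is a path. -/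
def IsLinear (d m : ℕ) (σ : Fin m → Finset ℕ) : Prop :=
  ∃ e : Fin m ≃ Fin m, ∀ i j : Fin m,
    DualAdj d m σ i j ↔ ((e i).val + 1 = (e j).val ∨ (e j).val + 1 = (e i).val)

abbrev St := Bool × Bool × Bool × Bool × ℕ

def bitsAll : List Bool := [true, false]

def cnt (b : Bool) : ℕ := if b then 1 else 0

def initSt : List St :=
  bitsAll.flatMap fun p => bitsAll.flatMap fun q => bitsAll.flatMap fun r =>
    bitsAll.flatMap fun t =>
      if p || q || r then [(p, q, r, t, cnt p + (cnt q + (cnt r + cnt t)))] else []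

def swp (s : St) : St := (s.2.1, s.1, s.2.2.1, s.2.2.2.1, s.2.2.2.2)

def rot (s : St) : St := (s.2.2.1, s.1, s.2.1, s.2.2.2.1, s.2.2.2.2)

/-- drop the first vertex and add a new one -/
def stp (B : ℕ) (s : St) : List St :=
  match s with
  | (p, q, r, t, e) =>
    if (p || q || t) && (p || r || t) then
      (if Nat.ble (e + 1) B then [(q, r, t, true, e + 1)] else []) ++ [(q, r, t, false, e)]
    else []

def impB (a b : Bool) : Bool :=
  match a, b with
  | true, b => b
  | false, _ => true

def domSt (s u : St) : Bool :=
  match s, u with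
  | (p, q, r, t, e), (p', q', r', t', e') =>
    impB p p' && (impB q q' && (impB r r' && (impB t t' && Nat.ble e' e)))

def anyDom (s : St) : List St → Bool
  | [] => false
  | u :: l => match domSt s u with
    | true => true
    | false => anyDom s l

def insSt (s : St) (l : List St) : List St :=
  match anyDom s l with
  | true => l
  | false => s :: l

def dd (l : List St) : List St := l.foldr insSt []

def stepAll (B : ℕ) (S : List St) : List St := dd (dd (S.flatMap (stp B))).reverse

def okSt (B : ℕ) (s : St) : Bool :=
  match s with
  | (p, q, r, t, e) => (p || q || t) && (p || r || t) && (q || r || t) && Nat.ble e B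

def pairOk (s u : St) : Bool :=
  Nat.ble 3 (cnt (s.1 || u.1) + (cnt (s.2.1 || u.2.1) +
    (cnt (s.2.2.1 || u.2.2.1) + cnt (s.2.2.2.1 || u.2.2.2.1))))

def finalOk (B : ℕ) (S : List St) : Bool :=
  S.any fun s => okSt B s && S.any fun u => okSt B u && pairOk s u

def forceB (b : Bool) (k : Bool → Bool) : Bool :=
  match b with
  | true => k true
  | false => k false

theorem forceB_eq (b k) : forceB b k = k b := by cases b <;> rfl

def forceN (e : ℕ) (k : ℕ → Bool) : Bool :=
  bif Nat.beq e 0 then k 0 else bif Nat.beq e 1 then k 1 else bif Nat.beq e 2 then k 2 else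
  bif Nat.beq e 3 then k 3 else bif Nat.beq e 4 then k 4 else bif Nat.beq e 5 then k 5 else k e

theorem forceN_eq (e k) : forceN e k = k e := by
  rcases e with _ | _ | _ | _ | _ | _ | e <;> rfl

def forceSt (s : St) (k : St → Bool) : Bool :=
  match s with
  | (p, q, r, t, e) => forceB p fun p => forceB q fun q => forceB r fun r => forceB t fun t =>
      forceN e fun e => k (p, q, r, t, e)

theorem forceSt_eq (s k) : forceSt s k = k s := by
  obtain ⟨p, q, r, t, e⟩ := s
  simp only [forceSt, forceB_eq, forceN_eq]

def forceL (l : List St) : (List St → Bool) → Bool :=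
  l.foldr (fun s F k => forceSt s fun s' => F fun l' => k (s' :: l')) (fun k => k [])

theorem forceL_eq (l : List St) : ∀ k, forceL l k = k l := by
  induction l with
  | nil => intro k; rfl
  | cons s l ih =>
    intro k
    change forceSt s (fun s' => forceL l fun l' => k (s' :: l')) = _
    rw [forceSt_eq, ih]

def chk (B : ℕ) : ℕ → List St → Bool
  | 0, S => finalOk B S
  | r + 1, S => forceL (S.flatMap (stp B)) (fun S => forceL (dd S) fun S => forceL (dd S.reverse) (chk B r)) &&
      (forceL ((S.map swp).flatMap (stp B)) (fun S => forceL (dd S) fun S => forceL (dd S.reverse) (chk B r)) &&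
      forceL ((S.map rot).flatMap (stp B)) (fun S => forceL (dd S) fun S => forceL (dd S.reverse) (chk B r)))

theorem chk_succ (B r : ℕ) (S : List St) : chk B (r + 1) S =
    (chk B r (stepAll B S) && (chk B r (stepAll B (S.map swp)) &&
      chk B r (stepAll B (S.map rot)))) := by
  simp only [chk, forceL_eq, stepAll]

theorem chk_all (n : ℕ) (hn : 4 ≤ n) (hn' : n ≤ 10) : chk (n / 2) (n - 4) initSt = true := by
  interval_cases n <;> decide +kernel

theorem dd_sub (l : List St) : ∀ s ∈ dd l, s ∈ l := by
  induction l with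
  | nil => intro s hs; exact hs
  | cons u l ih =>
    intro s hs
    change s ∈ insSt u (dd l) at hs
    unfold insSt at hs
    split at hs
    · exact List.mem_cons_of_mem _ (ih s hs)
    · rcases List.mem_cons.1 hs with h | h
      · exact h ▸ List.mem_cons_self
      · exact List.mem_cons_of_mem _ (ih s h)

theorem stepAll_sub (B : ℕ) (S : List St) : ∀ s ∈ stepAll B S, ∃ u ∈ S, s ∈ stp B u := by
  intro s hs
  have := dd_sub _ s (List.mem_reverse.1 (dd_sub _ s hs))
  simpa [List.mem_flatMap] using this

/-- Window condition. -/
def Win {m : ℕ} (σ : Fin m → Finset ℕ) (k : Fin m) (a b c d : ℕ) : Prop :=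
  σ k = {a, b, c, d} ∧ ∀ j : Fin m, k.val + 1 = j.val → d ∈ σ j

def WInv {m : ℕ} (σ : Fin m → Finset ℕ) (k : Fin m) (a b c d : ℕ) (s : St) : Prop :=
  ∃ T : Finset ℕ, T.card ≤ s.2.2.2.2 ∧ (∀ v ∈ T, ∃ i : Fin m, i.val ≤ k.val ∧ v ∈ σ i) ∧
    (s.1 = true ↔ a ∈ T) ∧ (s.2.1 = true ↔ b ∈ T) ∧ (s.2.2.1 = true ↔ c ∈ T) ∧
    (s.2.2.2.1 = true ↔ d ∈ T) ∧
    ∀ f ∈ sphereFacets 2 m σ, ((∃ i : Fin m, i.val < k.val ∧ f ⊆ σ i) ∨ f = {a, b, c}) →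
      (T ∩ f).Nonempty

theorem geo_step {m : ℕ} {σ : Fin m → Finset ℕ} (hB : IsStackedBall 2 m σ)
    (hP : IsPathOrder 2 m σ) (k j : Fin m) (hkj : k.val + 1 = j.val) :
    ∃ x ∈ σ k, ∃ y, (∀ i : Fin m, i.val ≤ k.val → y ∉ σ i) ∧
      σ j = insert y ((σ k).erase x) := by
  obtain ⟨η, hη, hηs, ⟨i, ⟨hi, hiη⟩, -⟩, hmem⟩ := hB.2 j (by omega)
  have hcj := hB.1 j
  have hck := hB.1 k
  have h1 : (σ j \ η).card = 1 := by rw [Finset.card_sdiff_of_subset hηs]; omega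
  obtain ⟨y, hy⟩ := Finset.card_eq_one.1 h1
  have hyj : y ∈ σ j ∧ y ∉ η := by
    have : y ∈ σ j \ η := by rw [hy]; simp
    simpa using this
  have hynew : ∀ i : Fin m, i.val ≤ k.val → y ∉ σ i := by
    intro i hi hyi
    have := (hmem {y} (by simpa using hyj.1)).1 ⟨i, by omega, by simpa using hyi⟩
    exact hyj.2 (by simpa using this)
  have hjeq : σ j = insert y η := by
    ext v
    have : v ∈ σ j \ η ↔ v ∈ ({y} : Finset ℕ) := by rw [hy]
    simp only [mem_sdiff, mem_singleton] at this
    simp only [mem_insert]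
    constructor
    · intro hv; by_cases hh : v ∈ η
      · exact Or.inr hh
      · exact Or.inl (this.1 ⟨hv, hh⟩)
    · rintro (rfl | hv)
      · exact hyj.1
      · exact hηs hv
  have hint : σ i ∩ σ j = η := by
    rw [hjeq]; ext v; simp only [mem_inter, mem_insert]
    constructor
    · rintro ⟨hv, rfl | hv'⟩
      · exact absurd hv (hynew i (by omega))
      · exact hv'
    · intro hv; exact ⟨hiη hv, Or.inr hv⟩
  have hadj := (hP i j).1 ⟨by intro h; rw [h] at hi; omega, by rw [hint]; exact hη⟩
  have hik : i = k := by apply Fin.ext; omega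
  subst hik
  have h2 : (σ i \ η).card = 1 := by rw [Finset.card_sdiff_of_subset hiη]; omega
  obtain ⟨x, hx⟩ := Finset.card_eq_one.1 h2
  have hxm : x ∈ σ i ∧ x ∉ η := by
    have : x ∈ σ i \ η := by rw [hx]; simp
    simpa using this
  refine ⟨x, hxm.1, y, hynew, ?_⟩
  rw [hjeq]; congr 1
  apply Finset.eq_of_subset_of_card_le
  · intro v hv
    exact Finset.mem_erase.2 ⟨fun h => hxm.2 (h ▸ hv), hiη hv⟩
  · rw [Finset.card_erase_of_mem hxm.1]; omega

theorem geo_new {m : ℕ} {σ : Fin m → Finset ℕ} (hB : IsStackedBall 2 m σ)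
    (hP : IsPathOrder 2 m σ) (k j l : Fin m) (hkj : k.val + 1 = j.val) (hjl : j.val + 1 = l.val)
    (x y : ℕ) (hx : x ∈ σ k) (hy : ∀ i : Fin m, i.val ≤ k.val → y ∉ σ i)
    (hj : σ j = insert y ((σ k).erase x)) : y ∈ σ l := by
  by_contra hyl
  obtain ⟨x', hx', y', hy', hl⟩ := geo_step hB hP j l hjl
  have hyj : y ∈ σ j := by rw [hj]; simp
  have : x' = y := by
    by_contra hne
    apply hyl; rw [hl]
    exact Finset.mem_insert_of_mem (Finset.mem_erase.2 ⟨fun h => hne h.symm, hyj⟩)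
  subst this
  have hnot : x' ∉ (σ k).erase x := fun h => hy k le_rfl (Finset.mem_of_mem_erase h)
  rw [hj, Finset.erase_insert hnot] at hl
  have hint : σ k ∩ σ l = (σ k).erase x := by
    rw [hl]; ext v; simp only [mem_inter, mem_insert]
    constructor
    · rintro ⟨hv, rfl | hv'⟩
      · exact absurd hv (hy' k (by omega))
      · exact hv'
    · intro hv; exact ⟨Finset.mem_of_mem_erase hv, Or.inr hv⟩
  have hck := hB.1 k
  have := (hP k l).1 ⟨by intro h; rw [h] at hkj; omega, by
    rw [hint, Finset.card_erase_of_mem hx]; omega⟩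
  omega

theorem win_ne {a b c d : ℕ} (h : ({a, b, c, d} : Finset ℕ).card = 4) :
    a ≠ b ∧ a ≠ c ∧ a ≠ d ∧ b ≠ c ∧ b ≠ d ∧ c ≠ d := by
  have key : ∀ x y z : ℕ, ¬ ({a, b, c, d} : Finset ℕ) ⊆ {x, y, z} := fun x y z hs => by
    have h1 := Finset.card_le_card hs
    have h2 := Finset.card_le_three (a := x) (b := y) (c := z)
    omega
  refine ⟨fun e => key b c d ?_, fun e => key b c d ?_, fun e => key b c d ?_,
    fun e => key a c d ?_, fun e => key a c d ?_, fun e => key a b d ?_⟩ <;>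
    · intro v hv
      simp only [mem_insert, mem_singleton] at hv ⊢
      omega

theorem sub_four {a b c d : ℕ} {f : Finset ℕ} (hf : f.card = 3)
    (hs : f ⊆ {a, b, c, d}) (h4 : ({a, b, c, d} : Finset ℕ).card = 4) :
    f = {a, b, c} ∨ (a ∈ f ∧ b ∈ f ∧ d ∈ f) ∨ (a ∈ f ∧ c ∈ f ∧ d ∈ f) ∨ f = {b, c, d} := by
  have h1 : (({a, b, c, d} : Finset ℕ) \ f).card = 1 := by
    rw [Finset.card_sdiff_of_subset hs]; omega
  obtain ⟨z, hz⟩ := Finset.card_eq_one.1 h1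
  have hfe : ∀ v, v ∈ f ↔ (v = a ∨ v = b ∨ v = c ∨ v = d) ∧ v ≠ z := by
    intro v
    have h2 : v ∈ (({a, b, c, d} : Finset ℕ) \ f) ↔ v = z := by rw [hz]; simp
    have h3 := @hs v
    simp only [mem_sdiff, mem_insert, mem_singleton] at h2 h3
    tauto
  have hzm : z = a ∨ z = b ∨ z = c ∨ z = d := by
    have : z ∈ (({a, b, c, d} : Finset ℕ) \ f) := by rw [hz]; simp
    simpa using (Finset.mem_sdiff.1 this).1
  obtain ⟨hab, hac, had, hbc, hbd, hcd⟩ := win_ne h4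
  rcases hzm with rfl | rfl | rfl | rfl
  · right; right; right; ext v; rw [hfe]; simp only [mem_insert, mem_singleton]; grind
  · right; right; left; simp only [hfe]; grind
  · right; left; simp only [hfe]; grind
  · left; ext v; rw [hfe]; simp only [mem_insert, mem_singleton]; grind

theorem geo_init {m : ℕ} {σ : Fin m → Finset ℕ} (hB : IsStackedBall 2 m σ)
    (k : Fin m) : k.val = 0 → IsPathOrder 2 m σ → ∃ a b c d, Win σ k a b c d := by
  intro hk hP
  have h4 := hB.1 k
  obtain ⟨d, hd, hdj⟩ : ∃ d ∈ σ k, ∀ j : Fin m, k.val + 1 = j.val → d ∈ σ j := by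
    by_cases hj : ∃ j : Fin m, k.val + 1 = j.val
    · obtain ⟨j, hj⟩ := hj
      have h3 := ((hP k j).2 (Or.inl hj)).2
      obtain ⟨d, hd⟩ : (σ k ∩ σ j).Nonempty := by
        rw [← Finset.card_pos]; omega
      refine ⟨d, (Finset.mem_inter.1 hd).1, fun j' hj' => ?_⟩
      have : j' = j := Fin.ext (by omega)
      exact this ▸ (Finset.mem_inter.1 hd).2
    · obtain ⟨d, hd⟩ : (σ k).Nonempty := by rw [← Finset.card_pos]; omega
      exact ⟨d, hd, fun j h => absurd ⟨j, h⟩ hj⟩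
  have h3 : ((σ k).erase d).card = 3 := by rw [Finset.card_erase_of_mem hd]; omega
  obtain ⟨a, b, c, -, -, -, he⟩ := Finset.card_eq_three.1 h3
  refine ⟨a, b, c, d, ?_, hdj⟩
  rw [← Finset.insert_erase hd, he]
  ext v; simp only [mem_insert, mem_singleton]; tauto

theorem inv_init {m : ℕ} {σ : Fin m → Finset ℕ} (hB : IsStackedBall 2 m σ)
    (k : Fin m) (hk : k.val = 0) {a b c d : ℕ} (hW : Win σ k a b c d) :
    ∀ s ∈ initSt, WInv σ k a b c d s := by
  have h4 := hB.1 k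
  rw [hW.1] at h4
  obtain ⟨hab, hac, had, hbc, hbd, hcd⟩ := win_ne h4
  rintro ⟨p, q, r, t, e⟩ hs
  have hs' : (p || q || r) = true ∧ e = cnt p + (cnt q + (cnt r + cnt t)) := by
    simp only [initSt, List.mem_flatMap] at hs
    obtain ⟨p', -, q', -, r', -, t', -, hs⟩ := hs
    split at hs
    · simp only [List.mem_singleton, Prod.mk.injEq] at hs
      obtain ⟨rfl, rfl, rfl, rfl, rfl⟩ := hs
      exact ⟨by assumption, rfl⟩
    · simp at hs
  obtain ⟨hor, rfl⟩ := hs'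
  let g : Bool → ℕ → Finset ℕ := fun b v => if b then {v} else ∅
  have hg : ∀ b v w, w ∈ g b v ↔ (b = true ∧ w = v) := by
    intro b v w; cases b <;> simp [g]
  have hgc : ∀ b v, (g b v).card ≤ cnt b := by
    intro b v; cases b <;> simp [g, cnt]
  refine ⟨g p a ∪ (g q b ∪ (g r c ∪ g t d)), ?_, ?_, ?_, ?_, ?_, ?_, ?_⟩
  · refine (Finset.card_union_le _ _).trans (add_le_add (hgc _ _) ?_)
    refine (Finset.card_union_le _ _).trans (add_le_add (hgc _ _) ?_)
    exact (Finset.card_union_le _ _).trans (add_le_add (hgc _ _) (hgc _ _))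
  · intro v hv
    refine ⟨k, le_rfl, ?_⟩
    rw [hW.1]
    simp only [mem_union, hg] at hv
    simp only [mem_insert, mem_singleton]
    tauto
  · simp only [mem_union, hg]; grind
  · simp only [mem_union, hg]; grind
  · simp only [mem_union, hg]; grind
  · simp only [mem_union, hg]; grind
  · rintro f - (⟨i, hi, -⟩ | rfl)
    · omega
    · simp only [Bool.or_eq_true] at hor
      rcases hor with (h | h) | h
      · exact ⟨a, by simp [hg, h]⟩
      · exact ⟨b, by simp [hg, h]⟩
      · exact ⟨c, by simp [hg, h]⟩

theorem win_swp {m : ℕ} {σ : Fin m → Finset ℕ} {k : Fin m} {a b c d : ℕ}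
    (h : Win σ k a b c d) : Win σ k b a c d :=
  ⟨by rw [h.1]; ext v; simp only [mem_insert, mem_singleton]; tauto, h.2⟩

theorem win_rot {m : ℕ} {σ : Fin m → Finset ℕ} {k : Fin m} {a b c d : ℕ}
    (h : Win σ k a b c d) : Win σ k c a b d :=
  ⟨by rw [h.1]; ext v; simp only [mem_insert, mem_singleton]; tauto, h.2⟩

theorem inv_swp {m : ℕ} {σ : Fin m → Finset ℕ} {k : Fin m} {a b c d : ℕ} {s : St}
    (h : WInv σ k a b c d s) : WInv σ k b a c d (swp s) := by
  obtain ⟨T, h1, h2, h3, h4, h5, h6, h7⟩ := h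
  refine ⟨T, h1, h2, h4, h3, h5, h6, ?_⟩
  have : ({b, a, c} : Finset ℕ) = {a, b, c} := by
    ext v; simp only [mem_insert, mem_singleton]; tauto
  rw [this]; exact h7

theorem inv_rot {m : ℕ} {σ : Fin m → Finset ℕ} {k : Fin m} {a b c d : ℕ} {s : St}
    (h : WInv σ k a b c d s) : WInv σ k c a b d (rot s) := by
  obtain ⟨T, h1, h2, h3, h4, h5, h6, h7⟩ := h
  refine ⟨T, h1, h2, h5, h3, h4, h6, ?_⟩
  have : ({c, a, b} : Finset ℕ) = {a, b, c} := by
    ext v; simp only [mem_insert, mem_singleton]; tauto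
  rw [this]; exact h7

theorem sub1 (a b c d : ℕ) : ({b, c, d} : Finset ℕ) ⊆ {a, b, c, d} :=
  Finset.subset_insert _ _

theorem sub2 (b c d y : ℕ) : ({b, c, d} : Finset ℕ) ⊆ {b, c, d, y} := by
  intro v; simp only [mem_insert, mem_singleton]; tauto

theorem stp_mem {B : ℕ} {p q r t : Bool} {e : ℕ} {s : St} (hs : s ∈ stp B (p, q, r, t, e)) :
    ((p || q || t) && (p || r || t)) = true ∧
      (s = (q, r, t, true, e + 1) ∨ s = (q, r, t, false, e)) := by
  simp only [stp] at hs
  split at hs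
  case isFalse => simp at hs
  case isTrue hc =>
    refine ⟨hc, ?_⟩
    split at hs
    · simpa using hs
    · right; simpa using hs

theorem inv_step {m : ℕ} {σ : Fin m → Finset ℕ} (hB : IsStackedBall 2 m σ)
    {k j : Fin m} (hkj : k.val + 1 = j.val) {a b c d y : ℕ} (hW : Win σ k a b c d)
    (hy : ∀ i : Fin m, i.val ≤ k.val → y ∉ σ i) (hj : σ j = {b, c, d, y})
    (B : ℕ) (S : List St) (hS : ∀ s ∈ S, WInv σ k a b c d s) :
    ∀ s ∈ stepAll B S, WInv σ j b c d y s := by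
  intro s hs
  obtain ⟨⟨p, q, r, t, e⟩, hu, hs⟩ := stepAll_sub B S s hs
  obtain ⟨T, h1, h2, h3, h4, h5, h6, h7⟩ := hS _ hu
  simp only at h1 h3 h4 h5 h6
  have hkc := hB.1 k
  rw [hW.1] at hkc
  have hyk := hy k le_rfl
  rw [hW.1] at hyk
  simp only [mem_insert, mem_singleton, not_or] at hyk
  have hyT : y ∉ T := fun h => by
    obtain ⟨i, hi, hm⟩ := h2 y h
    exact hy i hi hm
  obtain ⟨hc, hs'⟩ := stp_mem hs
  have hbcd : ({b, c, d} : Finset ℕ) ∉ sphereFacets 2 m σ := by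
    rintro ⟨-, i, -, hu⟩
    have e1 := hu k (by
      show ({b, c, d} : Finset ℕ) ⊆ σ k
      rw [hW.1]; exact sub1 a b c d)
    have e2 := hu j (by
      show ({b, c, d} : Finset ℕ) ⊆ σ j
      rw [hj]; exact sub2 b c d y)
    rw [← e2] at e1
    rw [e1] at hkj; omega
  have key : ∀ f ∈ sphereFacets 2 m σ,
      ((∃ i : Fin m, i.val < j.val ∧ f ⊆ σ i) ∨ f = {b, c, d}) → (T ∩ f).Nonempty := by
    rintro f hf (⟨i, hi, hfi⟩ | rfl)
    · by_cases hik : i.val < k.val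
      · exact h7 f hf (Or.inl ⟨i, hik, hfi⟩)
      · have : i = k := Fin.ext (by omega)
        subst this
        rw [hW.1] at hfi
        simp only [Bool.and_eq_true, Bool.or_eq_true] at hc
        rw [h3, h4, h5, h6] at hc
        rcases sub_four hf.1 hfi hkc with h | h | h | h
        · exact h7 f hf (Or.inr h)
        · rcases hc.1 with (g | g) | g
          · exact ⟨a, mem_inter.2 ⟨g, h.1⟩⟩
          · exact ⟨b, mem_inter.2 ⟨g, h.2.1⟩⟩
          · exact ⟨d, mem_inter.2 ⟨g, h.2.2⟩⟩
        · rcases hc.2 with (g | g) | g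
          · exact ⟨a, mem_inter.2 ⟨g, h.1⟩⟩
          · exact ⟨c, mem_inter.2 ⟨g, h.2.1⟩⟩
          · exact ⟨d, mem_inter.2 ⟨g, h.2.2⟩⟩
        · exact absurd (h ▸ hf) hbcd
    · exact absurd hf hbcd
  rcases hs' with rfl | rfl
  · refine ⟨insert y T, ?_, ?_, ?_, ?_, ?_, ?_, ?_⟩
    · exact (Finset.card_insert_le _ _).trans (by simpa using h1)
    · intro v hv
      rcases mem_insert.1 hv with rfl | hv
      · exact ⟨j, le_rfl, by rw [hj]; simp⟩
      · obtain ⟨i, hi, hm⟩ := h2 v hv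
        exact ⟨i, by omega, hm⟩
    · simp only [mem_insert]; rw [h4]; grind
    · simp only [mem_insert]; rw [h5]; grind
    · simp only [mem_insert]; rw [h6]; grind
    · simp
    · intro f hf h
      exact (key f hf h).mono (Finset.inter_subset_inter_right (Finset.subset_insert _ _))
  · refine ⟨T, h1, ?_, h4, h5, h6, by simpa using hyT, key⟩
    intro v hv
    obtain ⟨i, hi, hm⟩ := h2 v hv
    exact ⟨i, by omega, hm⟩

theorem final_sound {m : ℕ} {σ : Fin m → Finset ℕ} (hB : IsStackedBall 2 m σ)
    {k : Fin m} (hk : k.val + 1 = m) {a b c d : ℕ} (hW : Win σ k a b c d)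
    (B : ℕ) (S : List St) (hS : ∀ s ∈ S, WInv σ k a b c d s) (hc : finalOk B S = true) :
    ∃ T₁ T₂ : Finset ℕ, IsTransversal T₁ (sphereFacets 2 m σ) ∧
      IsTransversal T₂ (sphereFacets 2 m σ) ∧ T₁.card ≤ B ∧ T₂.card ≤ B ∧
      3 ≤ (σ k ∩ (T₁ ∪ T₂)).card := by
  have hkc := hB.1 k
  rw [hW.1] at hkc
  have key : ∀ s ∈ S, okSt B s = true → ∃ T : Finset ℕ, IsTransversal T (sphereFacets 2 m σ) ∧
      T.card ≤ B ∧ (s.1 = true ↔ a ∈ T) ∧ (s.2.1 = true ↔ b ∈ T) ∧ (s.2.2.1 = true ↔ c ∈ T) ∧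
      (s.2.2.2.1 = true ↔ d ∈ T) := by
    rintro ⟨p, q, r, t, e⟩ hs hok
    obtain ⟨T, h1, h2, h3, h4, h5, h6, h7⟩ := hS _ hs
    simp only [okSt, Bool.and_eq_true, Bool.or_eq_true, Nat.ble_eq] at hok
    simp only at h1 h3 h4 h5 h6
    refine ⟨T, ?_, h1.trans hok.2, h3, h4, h5, h6⟩
    rw [h3, h4, h5, h6] at hok
    intro f hf
    obtain ⟨i, hfi, -⟩ := hf.2
    by_cases hik : i.val < k.val
    · exact h7 f hf (Or.inl ⟨i, hik, hfi⟩)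
    · have : i = k := Fin.ext (by omega)
      subst this
      rw [hW.1] at hfi
      rcases sub_four hf.1 hfi hkc with h | h | h | h
      · exact h7 f hf (Or.inr h)
      · rcases hok.1.1.1 with (g | g) | g
        · exact ⟨a, mem_inter.2 ⟨g, h.1⟩⟩
        · exact ⟨b, mem_inter.2 ⟨g, h.2.1⟩⟩
        · exact ⟨d, mem_inter.2 ⟨g, h.2.2⟩⟩
      · rcases hok.1.1.2 with (g | g) | g
        · exact ⟨a, mem_inter.2 ⟨g, h.1⟩⟩
        · exact ⟨c, mem_inter.2 ⟨g, h.2.1⟩⟩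
        · exact ⟨d, mem_inter.2 ⟨g, h.2.2⟩⟩
      · rw [h]
        rcases hok.1.2 with (g | g) | g
        · exact ⟨b, by simp [g]⟩
        · exact ⟨c, by simp [g]⟩
        · exact ⟨d, by simp [g]⟩
  simp only [finalOk, List.any_eq_true, Bool.and_eq_true] at hc
  obtain ⟨s, hs, hso, u, hu, huo, hp⟩ := hc
  obtain ⟨T₁, t1, t2, t3, t4, t5, t6⟩ := key s hs hso
  obtain ⟨T₂, u1, u2, u3, u4, u5, u6⟩ := key u hu huo
  refine ⟨T₁, T₂, t1, u1, t2, u2, ?_⟩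
  have hp' := Nat.le_of_ble_eq_true hp
  refine hp'.trans (le_of_eq ?_)
  have hcnt : ∀ (x y : Bool) (v : ℕ), (x = true ↔ v ∈ T₁) → (y = true ↔ v ∈ T₂) →
      cnt (x || y) = if v ∈ T₁ ∪ T₂ then 1 else 0 := by
    intro x y v hx hy
    simp only [cnt, Bool.or_eq_true, hx, hy, mem_union]
  rw [hcnt _ _ _ t3 u3, hcnt _ _ _ t4 u4, hcnt _ _ _ t5 u5, hcnt _ _ _ t6 u6, hW.1]
  obtain ⟨hab, hac, had, hbc, hbd, hcd⟩ := win_ne hkc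
  rw [← Finset.filter_mem_eq_inter, Finset.card_filter, Finset.sum_insert (by simp [*]),
    Finset.sum_insert (by simp [*]), Finset.sum_insert (by simp [*]), Finset.sum_singleton]

theorem chk_sound {m : ℕ} {σ : Fin m → Finset ℕ} (hB : IsStackedBall 2 m σ)
    (hP : IsPathOrder 2 m σ) (B r : ℕ) : ∀ (k : Fin m), k.val + 1 + r = m →
    ∀ a b c d, Win σ k a b c d → ∀ S : List St, (∀ s ∈ S, WInv σ k a b c d s) →
    chk B r S = true →
    ∃ T₁ T₂ : Finset ℕ, IsTransversal T₁ (sphereFacets 2 m σ) ∧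
      IsTransversal T₂ (sphereFacets 2 m σ) ∧ T₁.card ≤ B ∧ T₂.card ≤ B ∧
      ∀ l : Fin m, l.val + 1 = m → 3 ≤ (σ l ∩ (T₁ ∪ T₂)).card := by
  induction r with
  | zero =>
    intro k hk a b c d hW S hS hc
    obtain ⟨T₁, T₂, h1, h2, h3, h4, h5⟩ := final_sound hB hk hW B S hS hc
    refine ⟨T₁, T₂, h1, h2, h3, h4, fun l hl => ?_⟩
    have : l = k := Fin.ext (by omega)
    exact this ▸ h5
  | succ r ih =>
    have main : ∀ (k j : Fin m), k.val + 1 = j.val → k.val + 1 + (r + 1) = m →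
        ∀ a b c d y, Win σ k a b c d → (∀ i : Fin m, i.val ≤ k.val → y ∉ σ i) →
        σ j = insert y ((σ k).erase a) → ∀ S : List St, (∀ s ∈ S, WInv σ k a b c d s) →
        chk B r (stepAll B S) = true →
        ∃ T₁ T₂ : Finset ℕ, IsTransversal T₁ (sphereFacets 2 m σ) ∧
          IsTransversal T₂ (sphereFacets 2 m σ) ∧ T₁.card ≤ B ∧ T₂.card ≤ B ∧
          ∀ l : Fin m, l.val + 1 = m → 3 ≤ (σ l ∩ (T₁ ∪ T₂)).card := by
      intro k j hkj hk a b c d y hW hy hj S hS hc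
      have hkc := hB.1 k
      rw [hW.1] at hkc
      obtain ⟨hab, hac, had, hbc, hbd, hcd⟩ := win_ne hkc
      have hj' : σ j = {b, c, d, y} := by
        rw [hj, hW.1]; ext v
        simp only [mem_insert, mem_erase, mem_singleton]; grind
      refine ih j (by omega) b c d y ⟨hj', fun l hl => ?_⟩ _
        (inv_step hB hkj hW hy hj' B S hS) hc
      exact geo_new hB hP k j l hkj hl a y (by rw [hW.1]; simp) hy hj
    intro k hk a b c d hW S hS hc
    rw [chk_succ, Bool.and_eq_true, Bool.and_eq_true] at hc
    have hjm : k.val + 1 < m := by omega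
    obtain ⟨x, hx, y, hy, hj⟩ := geo_step hB hP k ⟨k.val + 1, hjm⟩ rfl
    have hdj := hW.2 ⟨k.val + 1, hjm⟩ rfl
    have hxd : x ≠ d := by
      rintro rfl
      rw [hj] at hdj
      have : x ≠ y := fun h => hy k le_rfl (h ▸ hx)
      simp [this] at hdj
    have hx' := hx
    rw [hW.1] at hx'
    simp only [mem_insert, mem_singleton] at hx'
    rcases hx' with rfl | rfl | rfl | rfl
    · exact main k _ rfl hk _ b c d y hW hy hj S hS hc.1
    · refine main k _ rfl hk _ a c d y (win_swp hW) hy hj (S.map swp) ?_ hc.2.1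
      intro s hs
      obtain ⟨u, hu, rfl⟩ := List.mem_map.1 hs
      exact inv_swp (hS u hu)
    · refine main k _ rfl hk _ a b d y (win_rot hW) hy hj (S.map rot) ?_ hc.2.2
      intro s hs
      obtain ⟨u, hu, rfl⟩ := List.mem_map.1 hs
      exact inv_rot (hS u hu)
    · exact absurd rfl hxd

/-- **Base cases of the upper bound.** Let `S = ∂(σ₁,…,σ_{n−3})` be a linear stacked
`2`-sphere on `n` vertices with `4 ≤ n ≤ 10` (dual graph a path in this order). Then
there are transversals `T₁, T₂` of `S`, each of size at most `⌊n/2⌋`, such that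
`T₁ ∪ T₂` contains at least `3` vertices of `σ_{n−3}`. -/
theorem upper_bound_base_cases (n : ℕ) (hn : 4 ≤ n) (hn' : n ≤ 10)
    (σ : Fin (n - 3) → Finset ℕ)
    (hB : IsStackedBall 2 (n - 3) σ) (hP : IsPathOrder 2 (n - 3) σ)
    (hV : (vertexSet (n - 3) σ).card = n) :
    ∃ T₁ T₂ : Finset ℕ,
      IsTransversal T₁ (sphereFacets 2 (n - 3) σ) ∧
      IsTransversal T₂ (sphereFacets 2 (n - 3) σ) ∧
      T₁.card ≤ n / 2 ∧ T₂.card ≤ n / 2 ∧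
      3 ≤ ((σ ⟨n - 4, by omega⟩) ∩ (T₁ ∪ T₂)).card := by
  have h0 : 0 < n - 3 := by omega
  obtain ⟨a, b, c, d, hW⟩ := geo_init hB ⟨0, h0⟩ rfl hP
  have hI := inv_init hB ⟨0, h0⟩ rfl hW
  obtain ⟨T₁, T₂, h1, h2, h3, h4, h5⟩ := chk_sound hB hP (n / 2) (n - 4) ⟨0, h0⟩
    (by simp; omega) a b c d hW initSt hI (chk_all n hn hn')
  refine ⟨T₁, T₂, h1, h2, h3, h4, h5 _ ?_⟩
  simp; omega
end

section
/- Fix d ≥ 2 and let V = [d+2] ⊔ {a^{(i)}_j : i ∈ [d+1], j ∈ [d+2]} (all a^{(i)}_j distinct and disjoint from [d+2]). For permutations φ₁,…,φ_{d+1} of [d+2], define for each i ∈ [d+1] and j ∈ [d+1] the set τ^{(i)}_j = {φ_i(j+1), …, φ_i(d+2), a^{(i)}_1, …, a^{(i)}_j}, and τ^{(i)}_{d+2} = {a^{(i)}_1, …, a^{(i)}_{d+2}}. Suppose the (d+1)-simplices on [d+2] together with all τ^{(i)}_j (i ∈ [d+1], j ∈ [d+2]) form a stacked (d+1)-ball B,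 and let S_d = ∂B. Then every transversal T of S_d satisfies: for each i ∈ [d+1], |T ∩ τ^{(i)}_{d+2}| ≥ 1, and moreover if |T ∩ τ^{(i)}_{d+2}| = 1 for some i ∈ [d+1], then both φ_i(d+1) ∈ T and φ_i(d+2) ∈ T. -/
open Finset

/-- **Observation (general form).** Fix `d ≥ 2`, let the vertex set be
`[d+2] ⊔ {a i j : i ∈ [d+1], j ∈ [d+2]}` (all `a i j` distinct and outside `[d+2]`),
let each `φ i` (`i ∈ [d+1]`) be a permutation of `[d+2]`, and let
`τ⁽ⁱ⁾_j = {φ i (j+1), …, φ i (d+2), a i 1, …, a i j}`. Suppose the simplex `[d+2]`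
together with all `τ⁽ⁱ⁾_j` (`i ∈ [d+1]`, `j ∈ [d+2]`) form a stacked `(d+1)`-ball
(in some order `σ`), and let `S_d` be its boundary sphere. Then every transversal
`T` of `S_d` meets each `τ⁽ⁱ⁾_{d+2} = {a i 1, …, a i (d+2)}`, and if
`|T ∩ τ⁽ⁱ⁾_{d+2}| = 1` for some `i ∈ [d+1]` then `φ i (d+1) ∈ T` and `φ i (d+2) ∈ T`. -/
theorem observation_transversal_at_leaf (d : ℕ) (hd : 2 ≤ d)
    (a : ℕ → ℕ → ℕ) (φ : ℕ → ℕ → ℕ)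
    (ha_inj : ∀ i ∈ Finset.Icc 1 (d + 1), ∀ j ∈ Finset.Icc 1 (d + 2),
      ∀ i' ∈ Finset.Icc 1 (d + 1), ∀ j' ∈ Finset.Icc 1 (d + 2),
      a i j = a i' j' → i = i' ∧ j = j')
    (ha_new : ∀ i ∈ Finset.Icc 1 (d + 1), ∀ j ∈ Finset.Icc 1 (d + 2),
      a i j ∉ Finset.Icc 1 (d + 2))
    (hφ : ∀ i ∈ Finset.Icc 1 (d + 1),
      Set.BijOn (φ i) (Set.Icc 1 (d + 2)) (Set.Icc 1 (d + 2)))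
    (σ : Fin (1 + (d + 1) * (d + 2)) → Finset ℕ)
    (hB : IsStackedBall d (1 + (d + 1) * (d + 2)) σ)
    (hrange : Set.range σ =
      ({Finset.Icc 1 (d + 2)} : Set (Finset ℕ)) ∪
      {s | ∃ i ∈ Finset.Icc 1 (d + 1), ∃ j ∈ Finset.Icc 1 (d + 2),
        s = (Finset.Icc (j + 1) (d + 2)).image (φ i) ∪ (Finset.Icc 1 j).image (a i)})
    (T : Finset ℕ)
    (hT : IsTransversal T (sphereFacets d (1 + (d + 1) * (d + 2)) σ))
    (i : ℕ) (hi : i ∈ Finset.Icc 1 (d + 1)) :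
    1 ≤ (T ∩ (Finset.Icc 1 (d + 2)).image (a i)).card ∧
    ((T ∩ (Finset.Icc 1 (d + 2)).image (a i)).card = 1 →
      φ i (d + 1) ∈ T ∧ φ i (d + 2) ∈ T) := by
  have hi' := Finset.mem_Icc.1 hi
  have hinj : Function.Injective σ := by
    have key : ∀ p q, p.val < q.val → σ p ≠ σ q := by
      intro p q hpq h
      obtain ⟨η, h1, h2, h3, h4⟩ := hB.2 q (by omega)
      have := Finset.card_le_card ((h4 (σ q) (Finset.Subset.refl _)).1 ⟨p, hpq, h ▸ Finset.Subset.refl _⟩)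
      rw [hB.1 q] at this
      omega
    intro p q h
    rcases lt_trichotomy p.val q.val with h' | h' | h'
    · exact absurd h (key _ _ h')
    · exact Fin.ext h'
    · exact absurd h.symm (key _ _ h')
  have ainj : ∀ j j', 1 ≤ j → j ≤ d + 2 → 1 ≤ j' → j' ≤ d + 2 → a i j = a i j' → j = j' :=
    fun j j' h1 h2 h3 h4 h => (ha_inj i hi j (Finset.mem_Icc.2 ⟨h1, h2⟩) i hi j'
      (Finset.mem_Icc.2 ⟨h3, h4⟩) h).2
  have φinj : ∀ j j', 1 ≤ j → j ≤ d + 2 → 1 ≤ j' → j' ≤ d + 2 → φ i j = φ i j' → j = j' :=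
    fun j j' h1 h2 h3 h4 h => (hφ i hi).injOn ⟨h1, h2⟩ ⟨h3, h4⟩ h
  have φne : ∀ i' ∈ Finset.Icc 1 (d + 1), ∀ k, 1 ≤ k → k ≤ d + 2 → ∀ j, 1 ≤ j → j ≤ d + 2 →
      φ i' k ≠ a i j := by
    intro i' hi2 k hk hk' j hj hj' h
    have h1 := (hφ i' hi2).mapsTo (show k ∈ Set.Icc 1 (d + 2) from ⟨hk, hk'⟩)
    exact ha_new i hi j (Finset.mem_Icc.2 ⟨hj, hj'⟩) (h ▸ Finset.mem_Icc.2 h1)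
  -- criterion for facets
  have crit : ∀ (f : Finset ℕ) (j j0 : ℕ), f.card = d + 1 → 1 ≤ j → j ≤ d + 2 →
      1 ≤ j0 → j0 ≤ d + 2 → a i j0 ∈ f →
      f ⊆ (Finset.Icc (j + 1) (d + 2)).image (φ i) ∪ (Finset.Icc 1 j).image (a i) →
      (∀ j', j0 ≤ j' → j' ≤ d + 2 →
        f ⊆ (Finset.Icc (j' + 1) (d + 2)).image (φ i) ∪ (Finset.Icc 1 j').image (a i) → j' = j) →
      (T ∩ f).Nonempty := by
    intro f j j0 hc hj hj' h0 h0' haf hsub huniq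
    apply hT
    refine ⟨hc, ?_⟩
    have hm : ((Finset.Icc (j + 1) (d + 2)).image (φ i) ∪ (Finset.Icc 1 j).image (a i))
        ∈ Set.range σ := by
      rw [hrange]
      exact Or.inr ⟨i, hi, j, Finset.mem_Icc.2 ⟨hj, hj'⟩, rfl⟩
    obtain ⟨p, hp⟩ := hm
    refine ⟨p, by simpa only [hp] using hsub, ?_⟩
    intro q hq
    apply hinj
    have hm : σ q ∈ Set.range σ := ⟨q, rfl⟩
    rw [hrange] at hm
    rcases hm with hm | ⟨i', hi2, j', hj2, hm⟩
    · have hm : σ q = Finset.Icc 1 (d + 2) := hm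
      exact absurd (hm ▸ hq haf) (ha_new i hi j0 (Finset.mem_Icc.2 ⟨h0, h0'⟩))
    · have h := hq haf
      have hj3 := Finset.mem_Icc.1 hj2
      rw [hm, Finset.mem_union, Finset.mem_image, Finset.mem_image] at h
      rcases h with ⟨k, hk, h⟩ | ⟨k, hk, h⟩
      · have hk := Finset.mem_Icc.1 hk
        exact absurd h (φne i' hi2 k (by omega) (by omega) j0 h0 h0')
      · have hk := Finset.mem_Icc.1 hk
        obtain ⟨e1, e2⟩ := ha_inj i' hi2 k (Finset.mem_Icc.2 ⟨by omega, by omega⟩) i hi j0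
          (Finset.mem_Icc.2 ⟨h0, h0'⟩) h
        subst e1
        subst e2
        have hq' : f ⊆ σ q := hq
        rw [hm] at hq'
        have := huniq j' hk.2 hj3.2 hq'
        rw [hm, hp, this]
  have φmem : ∀ k j', 1 ≤ k → k ≤ d + 2 → j' ≤ d + 2 →
      φ i k ∈ (Finset.Icc (j' + 1) (d + 2)).image (φ i) ∪ (Finset.Icc 1 j').image (a i) →
      j' < k := by
    intro k j' hk hk' hj h
    rw [Finset.mem_union, Finset.mem_image, Finset.mem_image] at h
    rcases h with ⟨l, hl, h⟩ | ⟨l, hl, h⟩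
    · have hl := Finset.mem_Icc.1 hl
      have := φinj l k (by omega) (by omega) hk hk' h
      omega
    · have hl := Finset.mem_Icc.1 hl
      exact absurd h.symm (φne i hi k hk hk' l (by omega) (by omega))
  have acard : ∀ s : Finset ℕ, s ⊆ Finset.Icc 1 (d + 2) → (s.image (a i)).card = s.card := by
    intro s hs
    apply Finset.card_image_of_injOn
    intro x hx y hy h
    have h1 := Finset.mem_Icc.1 (hs hx)
    have h2 := Finset.mem_Icc.1 (hs hy)
    exact ainj x y h1.1 h1.2 h2.1 h2.2 h
  have A : ∀ j, 1 ≤ j → j ≤ d + 1 → ∃ k, 1 ≤ k ∧ k ≤ d + 2 ∧ k ≠ j ∧ a i k ∈ T := by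
    intro j hj hj'
    obtain ⟨x, hx⟩ := crit (((Finset.Icc 1 (d + 2)).erase j).image (a i)) (d + 2) (d + 2)
      (by
        rw [acard _ (Finset.erase_subset _ _), Finset.card_erase_of_mem
          (Finset.mem_Icc.2 ⟨hj, by omega⟩), Nat.card_Icc]
        omega) (by omega) le_rfl (by omega) le_rfl
      (Finset.mem_image_of_mem _ (Finset.mem_erase.2 ⟨by omega, Finset.mem_Icc.2 ⟨by omega, le_rfl⟩⟩))
      ((Finset.image_subset_image (Finset.erase_subset _ _)).trans Finset.subset_union_right)
      (fun j' h1 h2 _ => le_antisymm h2 h1)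
    obtain ⟨hxT, hx⟩ := Finset.mem_inter.1 hx
    obtain ⟨k, hk, rfl⟩ := Finset.mem_image.1 hx
    obtain ⟨hk, hk'⟩ := Finset.mem_erase.1 hk
    have := Finset.mem_Icc.1 hk'
    exact ⟨k, this.1, this.2, hk, hxT⟩
  have memI : ∀ k, 1 ≤ k → k ≤ d + 2 → a i k ∈ T →
      a i k ∈ T ∩ (Finset.Icc 1 (d + 2)).image (a i) := fun k h1 h2 h3 =>
    Finset.mem_inter.2 ⟨h3, Finset.mem_image_of_mem _ (Finset.mem_Icc.2 ⟨h1, h2⟩)⟩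
  constructor
  · obtain ⟨k, h1, h2, -, h3⟩ := A 1 le_rfl (by omega)
    exact Finset.card_pos.2 ⟨_, memI k h1 h2 h3⟩
  · intro hone
    have hno : ∀ k, 1 ≤ k → k ≤ d + 1 → a i k ∉ T := by
      intro k h1 h2 h3
      obtain ⟨l, l1, l2, l3, l4⟩ := A k h1 h2
      have := Finset.card_le_one.1 hone.le _ (memI k h1 (by omega) h3) _ (memI l l1 l2 l4)
      exact l3 (ainj l k l1 l2 h1 (by omega) this.symm)
    -- facets made of one old vertex and d new ones
    have B : ∀ c, 1 ≤ c → c ≤ 2 → φ i (d + c) ∈ T := by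
      intro c hc hc'
      have hsubI : Finset.Icc c (d + c - 1) ⊆ Finset.Icc 1 (d + 2) :=
        Finset.Icc_subset_Icc (by omega) (by omega)
      obtain ⟨x, hx⟩ := crit (insert (φ i (d + c)) ((Finset.Icc c (d + c - 1)).image (a i)))
        (d + c - 1) (d + c - 1)
        (by
          rw [Finset.card_insert_of_notMem, acard _ hsubI, Nat.card_Icc]
          · omega
          · intro h
            obtain ⟨k, hk, h⟩ := Finset.mem_image.1 h
            have hk := Finset.mem_Icc.1 hk
            exact φne i hi (d + c) (by omega) (by omega) k (by omega) (by omega) h.symm)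
        (by omega) (by omega) (by omega) (by omega)
        (Finset.mem_insert_of_mem (Finset.mem_image_of_mem _ (Finset.mem_Icc.2 ⟨by omega, le_rfl⟩)))
        (by
          apply Finset.insert_subset
          · exact Finset.mem_union_left _ (Finset.mem_image_of_mem _
              (Finset.mem_Icc.2 ⟨by omega, by omega⟩))
          · exact (Finset.image_subset_image (Finset.Icc_subset_Icc hc le_rfl)).trans
              Finset.subset_union_right)
        (fun j' h1 h2 h3 => by
          have := φmem (d + c) j' (by omega) (by omega) h2 (h3 (Finset.mem_insert_self _ _))
          omega)
      obtain ⟨hxT, hx⟩ := Finset.mem_inter.1 hx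
      rcases Finset.mem_insert.1 hx with rfl | hx
      · exact hxT
      · obtain ⟨k, hk, rfl⟩ := Finset.mem_image.1 hx
        have hk := Finset.mem_Icc.1 hk
        exact absurd hxT (hno k (by omega) (by omega))
    exact ⟨B 1 le_rfl (by omega), B 2 (by omega) le_rfl⟩
end

section
/- Fix d ≥ 2 and let V = [d+2] ⊔ {a^{(i)}_j : i ∈ [d+1], j ∈ [d+2]}. Define permutations φ_i of [d+2] by φ_i(j) ≡ i + j (mod d+2), and for each i ∈ [d+1] set τ^{(i)}_j = {φ_i(j+1), …, φ_i(d+2), a^{(i)}_1, …, a^{(i)}_j} for j ∈ [d+1] and τ^{(i)}_{d+2} = {a^{(i)}_1, …, a^{(i)}_{d+2}}. The (d+1)-simplices on [d+2] together with all τ^{(i)}_j form a well-defined stacked (d+1)-ball B; let S_d = ∂B, a stacked d-sphere on (d+2)² vertices. Let f = {φ₁(d+1), φ₁(d+2), a^{(1)}_2, …, a^{(1)}_d}; then f is a facet of S_d, and every transversal of the hypergraph of facets of S_d other than f has size at least 2d+3, i.e. τ(S_d − {f}) ≥ 2d+3. -/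
open Finset

/-- The permutation `φ_i` of `[d+2]` given by `φ_i(j) ≡ i + j (mod d+2)`
(with values taken in `{1, …, d+2}`). -/
def phiStd (d i j : ℕ) : ℕ := (i + j - 1) % (d + 2) + 1

/-- `τ⁽ⁱ⁾_j = {φ i (j+1), …, φ i (d+2), a i 1, …, a i j}`. -/
def tauSet (d : ℕ) (φ a : ℕ → ℕ → ℕ) (i j : ℕ) : Finset ℕ :=
  (Finset.Icc (j + 1) (d + 2)).image (φ i) ∪ (Finset.Icc 1 j).image (a i)


lemma phi_eq (d i l : ℕ) (hi : i ∈ Icc 1 (d+1)) (hl : l ∈ Icc 1 (d+2)) :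
    phiStd d i l = if i + l ≤ d + 2 then i + l else i + l - (d+2) := by
  simp only [mem_Icc] at hi hl
  unfold phiStd
  split_ifs with h
  · rw [Nat.mod_eq_of_lt (by omega)]; omega
  · rw [Nat.mod_eq_sub_mod (by omega), Nat.mod_eq_of_lt (by omega)]; omega

lemma phi_mem (d i l : ℕ) (hi : i ∈ Icc 1 (d+1)) (hl : l ∈ Icc 1 (d+2)) :
    phiStd d i l ∈ Icc 1 (d+2) := by
  rw [phi_eq d i l hi hl]
  simp only [mem_Icc] at *
  split_ifs <;> omega

lemma phi_inj (d i l l' : ℕ) (hi : i ∈ Icc 1 (d+1)) (hl : l ∈ Icc 1 (d+2))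
    (hl' : l' ∈ Icc 1 (d+2)) (h : phiStd d i l = phiStd d i l') : l = l' := by
  rw [phi_eq d i l hi hl, phi_eq d i l' hi hl'] at h
  simp only [mem_Icc] at *
  split_ifs at h <;> omega

def AInj (d : ℕ) (a : ℕ → ℕ → ℕ) : Prop :=
  ∀ i ∈ Finset.Icc 1 (d + 1), ∀ j ∈ Finset.Icc 1 (d + 2),
      ∀ i' ∈ Finset.Icc 1 (d + 1), ∀ j' ∈ Finset.Icc 1 (d + 2),
      a i j = a i' j' → i = i' ∧ j = j'

def ANew (d : ℕ) (a : ℕ → ℕ → ℕ) : Prop :=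
  ∀ i ∈ Finset.Icc 1 (d + 1), ∀ j ∈ Finset.Icc 1 (d + 2),
      a i j ∉ Finset.Icc 1 (d + 2)

lemma mem_tau (d : ℕ) (a : ℕ → ℕ → ℕ) (i j x : ℕ) : x ∈ tauSet d (phiStd d) a i j ↔
    (∃ l, (j + 1 ≤ l ∧ l ≤ d+2) ∧ phiStd d i l = x) ∨ (∃ l, (1 ≤ l ∧ l ≤ j) ∧ a i l = x) := by
  simp [tauSet]

lemma memA {d : ℕ} {a : ℕ → ℕ → ℕ} (h1 : AInj d a) (h2 : ANew d a) {i j i' j' : ℕ}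
    (hi : i ∈ Icc 1 (d+1)) (hj : j ∈ Icc 1 (d+2)) (hi' : i' ∈ Icc 1 (d+1)) (hj' : j' ≤ d+2) :
    a i j ∈ tauSet d (phiStd d) a i' j' ↔ i' = i ∧ j ≤ j' := by
  rw [mem_tau]
  constructor
  · rintro (⟨l, hl, h⟩ | ⟨l, hl, h⟩)
    · exact absurd (h ▸ phi_mem d i' l hi' (by simp; omega)) (h2 i hi j hj)
    · have := h1 i' hi' l (by simp; omega) i hi j hj h
      omega
  · rintro ⟨rfl, h⟩
    exact Or.inr ⟨j, ⟨(mem_Icc.1 hj).1, h⟩, rfl⟩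

lemma memP {d : ℕ} {a : ℕ → ℕ → ℕ} (h2 : ANew d a) {i j l : ℕ}
    (hi : i ∈ Icc 1 (d+1)) (hl : l ∈ Icc 1 (d+2)) (hj : j ≤ d+2) :
    phiStd d i l ∈ tauSet d (phiStd d) a i j ↔ j < l := by
  rw [mem_tau]
  constructor
  · rintro (⟨m, hm, h⟩ | ⟨m, hm, h⟩)
    · have := phi_inj d i m l hi (by simp; omega) hl h
      omega
    · exact absurd (h ▸ phi_mem d i l hi hl) (h2 i hi m (by simp; omega))
  · intro h
    exact Or.inl ⟨l, ⟨h, (mem_Icc.1 hl).2⟩, rfl⟩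

lemma card_tau {d : ℕ} {a : ℕ → ℕ → ℕ} (h1 : AInj d a) (h2 : ANew d a) {i j : ℕ}
    (hi : i ∈ Icc 1 (d+1)) (hj : j ≤ d+2) :
    (tauSet d (phiStd d) a i j).card = d + 2 := by
  unfold tauSet
  rw [card_union_of_disjoint, card_image_of_injOn, card_image_of_injOn]
  · simp; omega
  · intro x hx y hy h
    simp only [coe_Icc, Set.mem_Icc] at hx hy
    exact (h1 i hi x (by simp; omega) i hi y (by simp; omega) h).2
  · intro x hx y hy h
    simp only [coe_Icc, Set.mem_Icc] at hx hy
    exact phi_inj d i x y hi (by simp; omega) (by simp; omega) h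
  · rw [disjoint_left]
    intro x hx hy
    simp only [mem_image, mem_Icc] at hx hy
    obtain ⟨l, hl, rfl⟩ := hx
    obtain ⟨m, hm, h⟩ := hy
    exact absurd (h ▸ phi_mem d i l hi (by simp; omega)) (h2 i hi m (by simp; omega))

lemma tau_zero {d : ℕ} {a : ℕ → ℕ → ℕ} {i : ℕ} (hi : i ∈ Icc 1 (d+1)) :
    tauSet d (phiStd d) a i 0 = Icc 1 (d+2) := by
  have : tauSet d (phiStd d) a i 0 = (Icc 1 (d+2)).image (phiStd d i) := by
    simp [tauSet]
  rw [this]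
  apply eq_of_subset_of_card_le
  · intro x hx
    obtain ⟨l, hl, rfl⟩ := mem_image.1 hx
    exact phi_mem d i l hi hl
  · rw [card_image_of_injOn]
    intro x hx y hy h
    exact phi_inj d i x y hi hx hy h

def idx (d i j : ℕ) : ℕ := 1 + (i-1)*(d+2) + (j-1)

lemma idx_lt {d i j i' j' : ℕ} (hi : i ∈ Icc 1 (d+1)) (hj : j ∈ Icc 1 (d+2))
    (hi' : i' ∈ Icc 1 (d+1)) (hj' : j' ∈ Icc 1 (d+2)) (h : idx d i' j' < idx d i j) :
    i' < i ∨ (i' = i ∧ j' < j) := by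
  simp only [mem_Icc] at *
  unfold idx at h
  by_contra hc
  push Not at hc
  rcases hc.1.eq_or_lt with h3 | h3
  · subst h3
    have := hc.2 rfl
    omega
  · have : (i - 1 + 1) * (d+2) ≤ (i'-1)*(d+2) := Nat.mul_le_mul_right _ (by omega)
    rw [Nat.add_mul] at this
    omega

lemma idx_bound {d i j : ℕ} (hi : i ∈ Icc 1 (d+1)) (hj : j ∈ Icc 1 (d+2)) :
    idx d i j < 1 + (d+1)*(d+2) := by
  simp only [mem_Icc] at *
  unfold idx
  have : (i - 1 + 1) * (d+2) ≤ (d+1)*(d+2) := Nat.mul_le_mul_right _ (by omega)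
  rw [Nat.add_mul] at this
  omega

def sig (d : ℕ) (a : ℕ → ℕ → ℕ) (k : ℕ) : Finset ℕ :=
  if k = 0 then Icc 1 (d+2) else
    tauSet d (phiStd d) a ((k-1)/(d+2)+1) ((k-1)%(d+2)+1)

lemma sig_idx {d i j : ℕ} (a : ℕ → ℕ → ℕ) (hi : i ∈ Icc 1 (d+1)) (hj : j ∈ Icc 1 (d+2)) :
    sig d a (idx d i j) = tauSet d (phiStd d) a i j := by
  simp only [mem_Icc] at *
  unfold sig idx
  rw [if_neg (by omega)]
  have e : 1 + (i-1)*(d+2) + (j-1) - 1 = (j-1) + (i-1)*(d+2) := by omega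
  rw [e, Nat.add_mul_div_right _ _ (by omega), Nat.add_mul_mod_self_right,
    Nat.div_eq_of_lt (by omega), Nat.mod_eq_of_lt (by omega)]
  congr 1 <;> omega

lemma exists_idx {d k : ℕ} (hk : k < 1 + (d+1)*(d+2)) (h0 : 0 < k) :
    ∃ i ∈ Icc 1 (d+1), ∃ j ∈ Icc 1 (d+2), k = idx d i j := by
  refine ⟨(k-1)/(d+2)+1, ?_, (k-1)%(d+2)+1, ?_, ?_⟩
  · have : (k-1)/(d+2) < d+1 := Nat.div_lt_of_lt_mul (by rw [Nat.mul_comm]; omega)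
    simp; omega
  · have := Nat.mod_lt (k-1) (show 0 < d+2 by omega)
    simp; omega
  · unfold idx
    have := Nat.div_add_mod' (k-1) (d+2)
    simp only [Nat.add_sub_cancel]
    omega

lemma facet_mk {d : ℕ} {a : ℕ → ℕ → ℕ} {g : Finset ℕ} {i j : ℕ}
    (hi : i ∈ Icc 1 (d+1)) (hj : j ∈ Icc 1 (d+2)) (hc : g.card = d+1)
    (hg : g ⊆ tauSet d (phiStd d) a i j) (h0 : ¬ g ⊆ Icc 1 (d+2))
    (hu : ∀ i' ∈ Icc 1 (d+1), ∀ j' ∈ Icc 1 (d+2), g ⊆ tauSet d (phiStd d) a i' j' →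
      i' = i ∧ j' = j) :
    g ∈ sphereFacets d (1 + (d+1)*(d+2)) (fun k => sig d a k.val) := by
  refine ⟨hc, ⟨idx d i j, idx_bound hi hj⟩, ?_, ?_⟩
  · simpa only [sig_idx a hi hj] using hg
  · rintro ⟨k, hk⟩ hs
    simp only at hs
    rcases Nat.eq_zero_or_pos k with rfl | hp
    · exact absurd (by simpa [sig] using hs) h0
    · obtain ⟨i', hi', j', hj', rfl⟩ := exists_idx hk hp
      rw [sig_idx a hi' hj'] at hs
      obtain ⟨rfl, rfl⟩ := hu i' hi' j' hj' hs
      rfl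

lemma facet_zero {d : ℕ} {a : ℕ → ℕ → ℕ} (h2 : ANew d a) :
    (Icc 1 (d+2)).erase 1 ∈ sphereFacets d (1 + (d+1)*(d+2)) (fun k => sig d a k.val) := by
  refine ⟨by rw [card_erase_of_mem (by simp)]; simp, ⟨0, by omega⟩, ?_, ?_⟩
  · simp only [sig, if_true]; exact erase_subset _ _
  · rintro ⟨k, hk⟩ hs
    simp only at hs
    rcases Nat.eq_zero_or_pos k with rfl | hp
    · rfl
    · exfalso
      obtain ⟨i', hi', j', hj', rfl⟩ := exists_idx hk hp
      rw [sig_idx a hi' hj'] at hs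
      have h1 : (1:ℕ) ∈ Icc 1 (d+2) := by simp
      have e := phi_eq d i' 1 hi' h1
      have := (memP h2 hi' h1 (mem_Icc.1 hj').2).1 (hs (by
        simp only [mem_Icc] at hi'
        rw [e, if_pos (by omega)]
        simp; omega))
      simp only [mem_Icc] at hj'
      omega

lemma stacked {d : ℕ} {a : ℕ → ℕ → ℕ} (h1 : AInj d a) (h2 : ANew d a) :
    IsStackedBall d (1 + (d+1)*(d+2)) (fun k => sig d a k.val) := by
  constructor
  · rintro ⟨k, hk⟩
    simp only
    rcases Nat.eq_zero_or_pos k with rfl | hp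
    · simp [sig]
    · obtain ⟨i', hi', j', hj', rfl⟩ := exists_idx hk hp
      rw [sig_idx a hi' hj']
      exact card_tau h1 h2 hi' (mem_Icc.1 hj').2
  · rintro ⟨k, hk⟩ hp
    simp only at hp
    obtain ⟨i, hi, j, hj, rfl⟩ := exists_idx hk hp
    have hjj := mem_Icc.1 hj
    have hii := mem_Icc.1 hi
    have hmem : a i j ∈ tauSet d (phiStd d) a i j :=
      (memA h1 h2 hi hj hi hjj.2).2 ⟨rfl, le_rfl⟩
    have hsub : (tauSet d (phiStd d) a i j).erase (a i j) ⊆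
        tauSet d (phiStd d) a i (j-1) := by
      intro x hx
      rw [mem_erase, mem_tau] at hx
      rw [mem_tau]
      obtain ⟨hne, ⟨l, hl, rfl⟩ | ⟨l, hl, rfl⟩⟩ := hx
      · exact Or.inl ⟨l, by omega, rfl⟩
      · refine Or.inr ⟨l, ⟨hl.1, ?_⟩, rfl⟩
        have : l ≠ j := by rintro rfl; exact hne rfl
        omega
    have hex : ∃! q : Fin (1 + (d+1)*(d+2)), q.val < idx d i j ∧
        (tauSet d (phiStd d) a i j).erase (a i j) ⊆ sig d a q.val := by
      rcases hjj.1.eq_or_lt with h | h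
      · subst h
        refine ⟨⟨0, by omega⟩, ⟨hp, ?_⟩, ?_⟩
        · rw [Nat.sub_self, tau_zero hi] at hsub
          simpa [sig] using hsub
        · rintro ⟨q, hq⟩ ⟨hlt, hs⟩
          simp only at hlt hs
          rcases Nat.eq_zero_or_pos q with rfl | hqp
          · rfl
          · exfalso
            obtain ⟨i', hi', j', hj', rfl⟩ := exists_idx hq hqp
            rw [sig_idx a hi' hj'] at hs
            have hlt' := idx_lt hi hj hi' hj' hlt
            have hii' := mem_Icc.1 hi'
            have hjj' := mem_Icc.1 hj'
            have hlt2 : i' < i := by omega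
            have e' := phi_eq d i' 1 hi' hj
            rw [if_pos (by omega)] at e'
            -- i'+1 lies in C
            have hz : phiStd d i' 1 ∈ Icc 1 (d+2) := phi_mem d i' 1 hi' hj
            have hz2 := hz
            rw [← tau_zero (a := a) hi, mem_tau] at hz2
            obtain ⟨l, hl, e⟩ | ⟨l, hl, e⟩ := hz2
            · have hl1 : l ≠ 1 := by
                rintro rfl
                have e2 := phi_eq d i 1 hi hj
                rw [if_pos (by omega)] at e2
                omega
              have hin : phiStd d i' 1 ∈ (tauSet d (phiStd d) a i 1).erase (a i 1) := by
                rw [mem_erase]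
                refine ⟨fun hh => h2 i hi 1 hj (hh ▸ hz), ?_⟩
                rw [← e, memP h2 hi (by simp; omega) hjj.2]
                omega
              have := (memP h2 hi' hj hjj'.2).1 (hs hin)
              omega
            · omega
      · have hj1 : j - 1 ∈ Icc 1 (d+2) := by simp; omega
        refine ⟨⟨idx d i (j-1), idx_bound hi hj1⟩, ⟨?_, ?_⟩, ?_⟩
        · simp only [idx]; omega
        · simpa only [sig_idx a hi hj1] using hsub
        · rintro ⟨q, hq⟩ ⟨hlt, hs⟩
          simp only at hlt hs
          have hin : a i (j-1) ∈ (tauSet d (phiStd d) a i j).erase (a i j) := by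
            rw [mem_erase, memA h1 h2 hi hj1 hi hjj.2]
            refine ⟨fun hh => ?_, rfl, by omega⟩
            have := (h1 i hi _ hj1 i hi j hj hh).2
            omega
          have hin2 := hs hin
          rcases Nat.eq_zero_or_pos q with rfl | hqp
          · exact absurd (by simpa only [sig, if_true] using hin2) (h2 i hi _ hj1)
          · obtain ⟨i', hi', j', hj', rfl⟩ := exists_idx hq hqp
            rw [sig_idx a hi' hj', memA h1 h2 hi hj1 hi' (mem_Icc.1 hj').2] at hin2
            have hlt' := idx_lt hi hj hi' hj' hlt
            have e1 : i' = i := hin2.1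
            have e2 : j' = j - 1 := by omega
            subst e1 e2
            rfl
    refine ⟨(tauSet d (phiStd d) a i j).erase (a i j), ?_, ?_, hex, ?_⟩
    · rw [card_erase_of_mem hmem, card_tau h1 h2 hi hjj.2]; rfl
    · simp only [sig_idx a hi hj]; exact erase_subset _ _
    · intro t ht
      simp only [sig_idx a hi hj] at ht
      constructor
      · rintro ⟨⟨q, hq⟩, hlt, hs⟩
        simp only at hlt hs
        intro x hx
        rw [mem_erase]
        refine ⟨?_, ht hx⟩
        rintro rfl
        have hin2 := hs hx
        rcases Nat.eq_zero_or_pos q with rfl | hqp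
        · exact absurd (by simpa only [sig, if_true] using hin2) (h2 i hi _ hj)
        · obtain ⟨i', hi', j', hj', rfl⟩ := exists_idx hq hqp
          rw [sig_idx a hi' hj', memA h1 h2 hi hj hi' (mem_Icc.1 hj').2] at hin2
          have hlt' := idx_lt hi hj hi' hj' hlt
          omega
      · intro h
        obtain ⟨q, ⟨hq1, hq2⟩, -⟩ := hex
        exact ⟨q, hq1, h.trans hq2⟩

lemma range_sig (d : ℕ) (a : ℕ → ℕ → ℕ) :
    Set.range (fun k : Fin (1 + (d+1)*(d+2)) => sig d a k.val) =
        ({Finset.Icc 1 (d + 2)} : Set (Finset ℕ)) ∪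
        {s | ∃ i ∈ Finset.Icc 1 (d + 1), ∃ j ∈ Finset.Icc 1 (d + 2),
          s = tauSet d (phiStd d) a i j} := by
  ext s
  constructor
  · rintro ⟨⟨k, hk⟩, rfl⟩
    simp only
    rcases Nat.eq_zero_or_pos k with rfl | hp
    · left; simp [sig]
    · right
      obtain ⟨i', hi', j', hj', rfl⟩ := exists_idx hk hp
      exact ⟨i', hi', j', hj', sig_idx a hi' hj'⟩
  · rintro (h | ⟨i, hi, j, hj, rfl⟩)
    · rw [Set.mem_singleton_iff] at h
      exact ⟨⟨0, by omega⟩, by simp [sig, h]⟩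
    · exact ⟨⟨idx d i j, idx_bound hi hj⟩, sig_idx a hi hj⟩

lemma vertex_card {d : ℕ} {a : ℕ → ℕ → ℕ} (h1 : AInj d a) (h2 : ANew d a) :
    (vertexSet (1 + (d+1)*(d+2)) (fun k => sig d a k.val)).card = (d+2)^2 := by
  have : vertexSet (1 + (d+1)*(d+2)) (fun k => sig d a k.val) =
      Icc 1 (d+2) ∪ (Icc 1 (d+1) ×ˢ Icc 1 (d+2)).image (fun p => a p.1 p.2) := by
    ext x
    simp only [vertexSet, mem_biUnion, mem_univ, true_and, mem_union, mem_image, mem_product,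
      Prod.exists]
    constructor
    · rintro ⟨⟨k, hk⟩, hx⟩
      simp only at hx
      rcases Nat.eq_zero_or_pos k with rfl | hp
      · left; simpa only [sig, if_true] using hx
      · obtain ⟨i', hi', j', hj', rfl⟩ := exists_idx hk hp
        rw [sig_idx a hi' hj', mem_tau] at hx
        have := mem_Icc.1 hj'
        obtain ⟨l, hl, rfl⟩ | ⟨l, hl, rfl⟩ := hx
        · left; exact phi_mem d i' l hi' (by simp; omega)
        · right; exact ⟨i', l, ⟨hi', by simp; omega⟩, rfl⟩
    · rintro (h | ⟨i, j, ⟨hi, hj⟩, rfl⟩)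
      · exact ⟨⟨0, by omega⟩, by simpa only [sig, if_true] using h⟩
      · refine ⟨⟨idx d i j, idx_bound hi hj⟩, ?_⟩
        simp only [sig_idx a hi hj]
        exact (memA h1 h2 hi hj hi (mem_Icc.1 hj).2).2 ⟨rfl, le_rfl⟩
  rw [this, card_union_of_disjoint, card_image_of_injOn]
  · simp; ring
  · rintro ⟨i, j⟩ hp ⟨i', j'⟩ hp' h
    simp only [coe_product, Set.mem_prod, mem_coe] at hp hp'
    obtain ⟨rfl, rfl⟩ := h1 i hp.1 j hp.2 i' hp'.1 j' hp'.2 h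
    rfl
  · rw [disjoint_left]
    intro x hx hy
    simp only [mem_image, mem_product, Prod.exists] at hy
    obtain ⟨i, j, ⟨hi, hj⟩, rfl⟩ := hy
    exact h2 i hi j hj hx

def ff (d : ℕ) (a : ℕ → ℕ → ℕ) : Finset ℕ :=
  insert (phiStd d 1 (d + 1)) (insert (phiStd d 1 (d + 2)) ((Finset.Icc 2 d).image (a 1)))

lemma ff_eq {d : ℕ} {a : ℕ → ℕ → ℕ} (hd : 2 ≤ d) (h1 : AInj d a) (h2 : ANew d a) :
    ff d a = (tauSet d (phiStd d) a 1 d).erase (a 1 1) := by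
  have hi : 1 ∈ Icc 1 (d+1) := by simp
  have hj : 1 ∈ Icc 1 (d+2) := by simp
  ext x
  simp only [ff, mem_insert, mem_image, mem_Icc, mem_erase, mem_tau]
  constructor
  · rintro (rfl | rfl | ⟨l, hl, rfl⟩)
    · have hm := phi_mem d 1 (d+1) hi (by simp)
      exact ⟨fun h => h2 1 hi 1 hj (h ▸ hm), Or.inl ⟨d+1, by omega, rfl⟩⟩
    · have hm := phi_mem d 1 (d+2) hi (by simp)
      exact ⟨fun h => h2 1 hi 1 hj (h ▸ hm), Or.inl ⟨d+2, by omega, rfl⟩⟩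
    · refine ⟨fun h => ?_, Or.inr ⟨l, by omega, rfl⟩⟩
      have := (h1 1 hi l (by simp; omega) 1 hi 1 hj h).2
      omega
  · rintro ⟨hne, ⟨l, hl, rfl⟩ | ⟨l, hl, rfl⟩⟩
    · rcases (show l = d+1 ∨ l = d+2 by omega) with rfl | rfl
      · left; rfl
      · right; left; rfl
    · right; right
      have : l ≠ 1 := by rintro rfl; exact hne rfl
      exact ⟨l, by omega, rfl⟩

/-- erasing `y` from a window gives a facet as soon as a top `a` and a lowest `phi` survive -/
lemma facet_erase {d : ℕ} {a : ℕ → ℕ → ℕ} (h1 : AInj d a) (h2 : ANew d a) {i j y : ℕ}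
    (hi : i ∈ Icc 1 (d+1)) (hj : j ∈ Icc 1 (d+2)) (hy : y ∈ tauSet d (phiStd d) a i j)
    (ht : a i j ≠ y) (hb : j = d+2 ∨ phiStd d i (j+1) ≠ y) :
    (tauSet d (phiStd d) a i j).erase y ∈
      sphereFacets d (1 + (d+1)*(d+2)) (fun k => sig d a k.val) := by
  have hjj := mem_Icc.1 hj
  have hin : a i j ∈ (tauSet d (phiStd d) a i j).erase y := by
    rw [mem_erase, memA h1 h2 hi hj hi hjj.2]
    exact ⟨ht, rfl, le_rfl⟩
  refine facet_mk hi hj ?_ (erase_subset _ _) (fun h => h2 i hi j hj (h hin)) ?_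
  · rw [card_erase_of_mem hy, card_tau h1 h2 hi hjj.2]; rfl
  · intro i' hi' j' hj' hs
    have hjj' := mem_Icc.1 hj'
    have h3 := (memA h1 h2 hi hj hi' hjj'.2).1 (hs hin)
    obtain ⟨rfl, h4⟩ := h3
    refine ⟨rfl, ?_⟩
    rcases hb with hb | hb
    · omega
    · by_cases hjd : j = d+2
      · omega
      · have hl : j+1 ∈ Icc 1 (d+2) := by simp; omega
        have := (memP h2 hi hl hjj'.2).1 (hs (by
          rw [mem_erase, memP h2 hi hl hjj.2]
          exact ⟨hb, by omega⟩))
        omega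

lemma lower {d : ℕ} {a : ℕ → ℕ → ℕ} (hd : 2 ≤ d) (h1 : AInj d a) (h2 : ANew d a)
    (T : Finset ℕ) (hT : IsTransversal T
      (sphereFacets d (1 + (d+1)*(d+2)) (fun k => sig d a k.val) \ {ff d a})) :
    2*d+3 ≤ T.card := by
  have hone : 1 ∈ Icc 1 (d+1) := by simp
  have hone' : 1 ∈ Icc 1 (d+2) := by simp
  have hD : d ∈ Icc 1 (d+2) := by simp; omega
  have hD1 : d+1 ∈ Icc 1 (d+2) := by simp
  have hD2 : d+2 ∈ Icc 1 (d+2) := by simp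
  have hff := ff_eq hd h1 h2
  have hap : ∀ i ∈ Icc 1 (d+1), ∀ j ∈ Icc 1 (d+2), ∀ i' ∈ Icc 1 (d+1), ∀ l ∈ Icc 1 (d+2),
      a i j ≠ phiStd d i' l := fun i hi j hj i' hi' l hl h =>
    h2 i hi j hj (h ▸ phi_mem d i' l hi' hl)
  have hffA : ∀ i ∈ Icc 1 (d+1), ∀ j ∈ Icc 1 (d+2), a i j ∈ ff d a → i = 1 ∧ j ≤ d := by
    intro i hi j hj h
    rw [hff, mem_erase, memA h1 h2 hi hj hone (by omega)] at h
    omega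
  -- facets met
  have meet : ∀ g ∈ sphereFacets d (1 + (d+1)*(d+2)) (fun k => sig d a k.val), g ≠ ff d a →
      ∃ x ∈ T, x ∈ g := by
    intro g hg hne
    obtain ⟨x, hx⟩ := hT g ⟨hg, by simpa using hne⟩
    exact ⟨x, (mem_inter.1 hx).1, (mem_inter.1 hx).2⟩
  set A : ℕ → Finset ℕ := fun i => (Icc 1 (d+2)).image (a i) with hA
  have hAt : ∀ i, tauSet d (phiStd d) a i (d+2) = A i := by
    intro i; simp [tauSet, hA]
  have m0 : (T ∩ Icc 1 (d+2)).Nonempty := by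
    obtain ⟨x, hx, hx'⟩ := meet _ (facet_zero h2) (by
      intro h
      have h3 : a 1 2 ∈ ff d a := by
        simp only [ff, mem_insert, mem_image]
        exact Or.inr (Or.inr ⟨2, by simp; omega, rfl⟩)
      rw [← h] at h3
      exact h2 1 hone 2 (by simp) (mem_of_mem_erase h3))
    exact ⟨x, mem_inter.2 ⟨hx, mem_of_mem_erase hx'⟩⟩
  have m2 : ∀ i ∈ Icc 1 (d+1), ∀ j ∈ Icc 1 (d+1), ∃ x ∈ T, x ∈ (A i).erase (a i j) := by
    intro i hi j hj
    have hj' : j ∈ Icc 1 (d+2) := by simp at *; omega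
    have hne : a i (d+2) ≠ a i j := by
      intro h
      have := (h1 i hi _ hD2 i hi j hj' h).2
      simp at hj; omega
    rw [← hAt]
    refine meet _ (facet_erase h1 h2 hi hD2 ?_ hne (Or.inl rfl)) ?_
    · rw [memA h1 h2 hi hj' hi le_rfl]
      exact ⟨rfl, (mem_Icc.1 hj').2⟩
    · intro h
      have := hffA i hi (d+2) hD2 (by
        rw [← h, mem_erase, memA h1 h2 hi hD2 hi le_rfl]
        exact ⟨hne, rfl, le_rfl⟩)
      omega
  have m3 : ∀ i ∈ Icc 1 (d+1), ∃ x ∈ T, x ∈ (tauSet d (phiStd d) a i (d+1)).erase (a i 1) := by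
    intro i hi
    have hne : a i (d+1) ≠ a i 1 := by
      intro h
      have := (h1 i hi _ hD1 i hi 1 hone' h).2
      omega
    refine meet _ (facet_erase h1 h2 hi hD1 ?_ hne
      (Or.inr (hap i hi 1 hone' i hi _ hD2).symm)) ?_
    · rw [memA h1 h2 hi hone' hi (by omega)]
      exact ⟨rfl, by omega⟩
    · intro h
      have := hffA i hi (d+1) hD1 (by
        rw [← h, mem_erase, memA h1 h2 hi hD1 hi (by omega)]
        exact ⟨hne, rfl, le_rfl⟩)
      omega
  have m4 : ∀ i ∈ Icc 1 (d+1), ∃ x ∈ T,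
      x ∈ (tauSet d (phiStd d) a i d).erase (phiStd d i (d+2)) := by
    intro i hi
    refine meet _ (facet_erase h1 h2 hi hD ?_ (hap i hi d hD i hi _ hD2) (Or.inr ?_)) ?_
    · rw [memP h2 hi hD2 (by omega)]; omega
    · intro h
      have := phi_inj d i _ _ hi hD1 hD2 h
      omega
    · intro h
      have h3 := hffA i hi d hD (by
        rw [← h, mem_erase, memA h1 h2 hi hD hi (by omega)]
        exact ⟨hap i hi d hD i hi _ hD2, rfl, le_rfl⟩)
      obtain ⟨rfl, -⟩ := h3
      have : phiStd d 1 (d+2) ∈ ff d a := by simp [ff]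
      rw [← h] at this
      simp at this
  -- arms
  have ne1 : ∀ i ∈ Icc 1 (d+1), 1 ≤ (T ∩ A i).card := by
    intro i hi
    obtain ⟨x, hx, hx'⟩ := m2 i hi 1 hone
    exact card_pos.2 ⟨x, mem_inter.2 ⟨hx, mem_of_mem_erase hx'⟩⟩
  have one : ∀ i ∈ Icc 1 (d+1), (T ∩ A i).card < 2 →
      phiStd d i (d+2) ∈ T ∧ phiStd d i (d+1) ∈ T := by
    intro i hi hlt
    have hno : ∀ j ∈ Icc 1 (d+1), a i j ∉ T := by
      intro j hj hjT
      obtain ⟨x, hx, hx'⟩ := m2 i hi j hj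
      have hj' : j ∈ Icc 1 (d+2) := by simp at *; omega
      rw [mem_erase] at hx'
      have : 1 < (T ∩ A i).card := one_lt_card.2 ⟨x, mem_inter.2 ⟨hx, hx'.2⟩, a i j,
        mem_inter.2 ⟨hjT, mem_image_of_mem _ hj'⟩, hx'.1⟩
      omega
    constructor
    · obtain ⟨x, hx, hx'⟩ := m3 i hi
      rw [mem_erase, mem_tau] at hx'
      obtain ⟨-, ⟨l, hl, rfl⟩ | ⟨l, hl, rfl⟩⟩ := hx'
      · have : l = d+2 := by omega
        rwa [this] at hx
      · exact absurd hx (hno l (by simp; omega))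
    · obtain ⟨x, hx, hx'⟩ := m4 i hi
      rw [mem_erase, mem_tau] at hx'
      obtain ⟨hne, ⟨l, hl, rfl⟩ | ⟨l, hl, rfl⟩⟩ := hx'
      · have : l ≠ d+2 := by rintro rfl; exact hne rfl
        have : l = d+1 := by omega
        rwa [this] at hx
      · exact absurd hx (hno l (by simp; omega))
  set I := (Icc 1 (d+1)).filter (fun i => (T ∩ A i).card < 2) with hI
  have hI0 : I.card + 1 ≤ (T ∩ Icc 1 (d+2)).card := by
    rcases I.eq_empty_or_nonempty with h | h
    · rw [h]; simpa using m0
    · have hm := I.min'_mem h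
      set m := I.min' h with hmdef
      have hmI := hm
      rw [hI, mem_filter] at hm
      have hm1 := mem_Icc.1 hm.1
      have e := phi_eq d m (d+1) hm.1 hD1
      have hnot : phiStd d m (d+1) ∉ I := by
        intro hc
        have h5 := I.min'_le _ hc
        rw [← hmdef] at h5
        have h6 := mem_Icc.1 (mem_filter.1 hc).1
        split_ifs at e <;> omega
      rw [← card_insert_of_notMem hnot]
      apply card_le_card
      intro x hx
      rw [mem_inter]
      rcases mem_insert.1 hx with rfl | hx
      · exact ⟨(one m hm.1 hm.2).2, phi_mem d m _ hm.1 hD1⟩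
      · rw [hI, mem_filter] at hx
        have h7 := (one x hx.1 hx.2).1
        have h8 := mem_Icc.1 hx.1
        rw [phi_eq d x (d+2) hx.1 hD2, if_neg (by omega)] at h7
        exact ⟨by simpa using h7, by simp; omega⟩
  have hsum : 2*(d+1) ≤ (∑ i ∈ Icc 1 (d+1), (T ∩ A i).card) + I.card := by
    rw [hI, card_filter, ← sum_add_distrib]
    calc 2*(d+1) = ∑ i ∈ Icc 1 (d+1), 2 := by simp; ring
      _ ≤ _ := by
        apply sum_le_sum
        intro i hi
        have := ne1 i hi
        split_ifs <;> omega
  have hdisj : (∑ i ∈ Icc 1 (d+1), (T ∩ A i).card) + (T ∩ Icc 1 (d+2)).card ≤ T.card := by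
    rw [← card_biUnion, ← card_union_of_disjoint]
    · apply card_le_card
      intro x hx
      simp only [mem_union, mem_biUnion, mem_inter] at hx
      tauto
    · rw [disjoint_left]
      intro x hx hy
      simp only [mem_biUnion, mem_inter, hA, mem_image] at hx hy
      obtain ⟨i, hi, -, j, hj, rfl⟩ := hx
      exact h2 i hi j hj hy.2
    · intro i hi i' hi' hne
      rw [Function.onFun, disjoint_left]
      intro x hx hy
      simp only [mem_inter, hA, mem_image] at hx hy
      obtain ⟨-, j, hj, rfl⟩ := hx
      obtain ⟨-, j', hj', h⟩ := hy
      exact hne (h1 i' hi' j' hj' i hi j hj h).1.symm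
  omega

/-- **Claim in the proof of the general lower bound.** Fix `d ≥ 2` and take the vertex
set `[d+2] ⊔ {a i j : i ∈ [d+1], j ∈ [d+2]}` and the permutations
`φ_i(j) ≡ i + j (mod d+2)` of `[d+2]`. Then the simplex `[d+2]` together with all
`τ⁽ⁱ⁾_j` (`i ∈ [d+1]`, `j ∈ [d+2]`) form a well-defined stacked `(d+1)`-ball whose
boundary `S_d` is a stacked `d`-sphere on `(d+2)²` vertices,
`f = {φ₁(d+1), φ₁(d+2), a 1 2, …, a 1 d}` is a facet of `S_d`, and
`τ(S_d − {f}) ≥ 2d+3`. -/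
theorem explicit_general_construction (d : ℕ) (hd : 2 ≤ d)
    (a : ℕ → ℕ → ℕ)
    (ha_inj : ∀ i ∈ Finset.Icc 1 (d + 1), ∀ j ∈ Finset.Icc 1 (d + 2),
      ∀ i' ∈ Finset.Icc 1 (d + 1), ∀ j' ∈ Finset.Icc 1 (d + 2),
      a i j = a i' j' → i = i' ∧ j = j')
    (ha_new : ∀ i ∈ Finset.Icc 1 (d + 1), ∀ j ∈ Finset.Icc 1 (d + 2),
      a i j ∉ Finset.Icc 1 (d + 2)) :
    ∃ σ : Fin (1 + (d + 1) * (d + 2)) → Finset ℕ,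
      IsStackedBall d (1 + (d + 1) * (d + 2)) σ ∧
      Set.range σ =
        ({Finset.Icc 1 (d + 2)} : Set (Finset ℕ)) ∪
        {s | ∃ i ∈ Finset.Icc 1 (d + 1), ∃ j ∈ Finset.Icc 1 (d + 2),
          s = tauSet d (phiStd d) a i j} ∧
      (vertexSet (1 + (d + 1) * (d + 2)) σ).card = (d + 2) ^ 2 ∧
      (insert (phiStd d 1 (d + 1)) (insert (phiStd d 1 (d + 2))
          ((Finset.Icc 2 d).image (a 1))))
        ∈ sphereFacets d (1 + (d + 1) * (d + 2)) σ ∧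
      2 * d + 3 ≤ tau (sphereFacets d (1 + (d + 1) * (d + 2)) σ \
        ({insert (phiStd d 1 (d + 1)) (insert (phiStd d 1 (d + 2))
          ((Finset.Icc 2 d).image (a 1)))} : Set (Finset ℕ))) := by
  refine ⟨fun k => sig d a k.val, stacked ha_inj ha_new, range_sig d a,
    vertex_card ha_inj ha_new, ?_, ?_⟩
  · change ff d a ∈ _
    have hone : 1 ∈ Icc 1 (d+1) := by simp
    have hone' : 1 ∈ Icc 1 (d+2) := by simp
    have hD : d ∈ Icc 1 (d+2) := by simp; omega
    rw [ff_eq hd ha_inj ha_new]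
    refine facet_erase ha_inj ha_new hone hD ?_ ?_ (Or.inr ?_)
    · exact (memA ha_inj ha_new hone hone' hone (by omega)).2 ⟨rfl, by omega⟩
    · intro h
      have := (ha_inj 1 hone d hD 1 hone 1 hone' h).2
      omega
    · intro h
      exact ha_new 1 hone 1 hone' (h ▸ phi_mem d 1 (d+1) hone (by simp))
  · change 2*d+3 ≤ tau (_ \ {ff d a})
    unfold tau
    apply le_csInf
    · refine ⟨_, vertexSet (1 + (d+1)*(d+2)) (fun k => sig d a k.val), rfl, ?_⟩
      rintro e ⟨⟨hc, i, hi, -⟩, -⟩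
      obtain ⟨x, hx⟩ : e.Nonempty := card_pos.1 (by omega)
      exact ⟨x, mem_inter.2 ⟨mem_biUnion.2 ⟨i, mem_univ _, hi hx⟩, hx⟩⟩
    · rintro n ⟨T, rfl, hT⟩
      exact lower hd ha_inj ha_new T hT
end

section
/- Let V = {1,2,3,4} ⊔ {a^{(i)}_j : i ∈ [3], j ∈ [3]} (13 distinct vertices). For permutations φ₁, φ₂, φ₃ of [4], define τ^{(i)}_j = {φ_i(j+1), …, φ_i(4), a^{(i)}_1, …, a^{(i)}_j} for i, j ∈ [3]. Suppose the 3-simplices on {1,2,3,4} together with all τ^{(i)}_j (i, j ∈ [3]) form a stacked 3-ball B, and let S₂ = ∂B. Then every transversal T of S₂ satisfies: for each i ∈ [3], |T ∩ {a^{(i)}_1, a^{(i)}_2, a^{(i)}_3}| ≥ 1, and moreover if |T ∩ {a^{(i)}_1, a^{(i)}_2, a^{(i)}_3}| = 1 for some i ∈ [3], then either φ_i(4) ∈ T or {φ_i(2), φ_i(3)} ⊆ T. -/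
open Finset

/-- **Observation (`13`-vertex form).** Let the vertex set be
`{1,2,3,4} ⊔ {a i j : i ∈ [3], j ∈ [3]}` (13 distinct vertices), let `φ₁, φ₂, φ₃` be
permutations of `[4]`, and let `τ⁽ⁱ⁾_j = {φ i (j+1), …, φ i 4, a i 1, …, a i j}` for
`i, j ∈ [3]`. Suppose the simplex `{1,2,3,4}` together with all `τ⁽ⁱ⁾_j` form a
stacked `3`-ball (in some order `σ`) and let `S₂` be its boundary sphere. Then every
transversal `T` of `S₂` meets each `{a i 1, a i 2, a i 3}`, and if
`|T ∩ {a i 1, a i 2, a i 3}| = 1` for some `i ∈ [3]` then `φ i 4 ∈ T` or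
`{φ i 2, φ i 3} ⊆ T`. -/
theorem observation_transversal_at_leaf_13 (a : ℕ → ℕ → ℕ) (φ : ℕ → ℕ → ℕ)
    (ha_inj : ∀ i ∈ Finset.Icc 1 3, ∀ j ∈ Finset.Icc 1 3,
      ∀ i' ∈ Finset.Icc 1 3, ∀ j' ∈ Finset.Icc 1 3,
      a i j = a i' j' → i = i' ∧ j = j')
    (ha_new : ∀ i ∈ Finset.Icc 1 3, ∀ j ∈ Finset.Icc 1 3,
      a i j ∉ Finset.Icc 1 4)
    (hφ : ∀ i ∈ Finset.Icc 1 3,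
      Set.BijOn (φ i) (Set.Icc 1 4) (Set.Icc 1 4))
    (σ : Fin 10 → Finset ℕ)
    (hB : IsStackedBall 2 10 σ)
    (hrange : Set.range σ =
      ({Finset.Icc 1 4} : Set (Finset ℕ)) ∪
      {s | ∃ i ∈ Finset.Icc 1 3, ∃ j ∈ Finset.Icc 1 3,
        s = (Finset.Icc (j + 1) 4).image (φ i) ∪ (Finset.Icc 1 j).image (a i)})
    (T : Finset ℕ)
    (hT : IsTransversal T (sphereFacets 2 10 σ))
    (i : ℕ) (hi : i ∈ Finset.Icc 1 3) :
    1 ≤ (T ∩ ({a i 1, a i 2, a i 3} : Finset ℕ)).card ∧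
    ((T ∩ ({a i 1, a i 2, a i 3} : Finset ℕ)).card = 1 →
      φ i 4 ∈ T ∨ (φ i 2 ∈ T ∧ φ i 3 ∈ T)) := by
  obtain ⟨hcard, hst⟩ := hB
  have hinj : Function.Injective σ := by
    have key : ∀ x y : Fin 10, x.val < y.val → σ x ≠ σ y := by
      intro x y hxy he
      obtain ⟨η, h1, _, _, h4⟩ := hst y (by omega)
      have := Finset.card_le_card ((h4 (σ y) (Finset.Subset.refl _)).1 ⟨x, hxy, by rw [he]⟩)
      have := hcard y
      omega
    intro x y he
    by_contra hne
    rcases Nat.lt_or_gt_of_ne (fun h => hne (Fin.ext h)) with h | h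
    · exact key x y h he
    · exact key y x h he.symm
  have hp4 : ∀ i ∈ Finset.Icc 1 3, ∀ k ∈ Finset.Icc 1 4, φ i k ∈ Finset.Icc 1 4 := by
    intro i hi k hk
    have := (hφ i hi).1 (Set.mem_Icc.2 (Finset.mem_Icc.1 hk))
    exact Finset.mem_Icc.2 (Set.mem_Icc.1 this)
  have hpinj : ∀ k ∈ Finset.Icc 1 4, ∀ l ∈ Finset.Icc 1 4, φ i k = φ i l → k = l := by
    intro k hk l hl h
    exact (hφ i hi).2.1 (Set.mem_Icc.2 (Finset.mem_Icc.1 hk))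
      (Set.mem_Icc.2 (Finset.mem_Icc.1 hl)) h
  have hpa : ∀ k ∈ Finset.Icc 1 4, ∀ j ∈ Finset.Icc 1 3, φ i k ≠ a i j := by
    intro k hk j hj h
    exact ha_new i hi j hj (h ▸ hp4 i hi k hk)
  have hmema : ∀ j ∈ Finset.Icc 1 3, ∀ i' ∈ Finset.Icc 1 3, ∀ j' ∈ Finset.Icc 1 3,
      a i j ∈ (Finset.Icc (j' + 1) 4).image (φ i') ∪ (Finset.Icc 1 j').image (a i') →
      i = i' ∧ j ≤ j' := by
    intro j hj i' hi' j' hj' h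
    rcases Finset.mem_union.1 h with h | h
    · obtain ⟨k, hk, e⟩ := Finset.mem_image.1 h
      refine absurd (hp4 i' hi' k ?_) (e ▸ ha_new i hi j hj)
      simp only [Finset.mem_Icc] at *
      omega
    · obtain ⟨k, hk, e⟩ := Finset.mem_image.1 h
      have := ha_inj i hi j hj i' hi' k (by simp only [Finset.mem_Icc] at *; omega) e.symm
      simp only [Finset.mem_Icc] at *
      omega
  have hmemp : ∀ k ∈ Finset.Icc 1 4, ∀ j' ∈ Finset.Icc 1 3,
      φ i k ∈ (Finset.Icc (j' + 1) 4).image (φ i) ∪ (Finset.Icc 1 j').image (a i) →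
      j' + 1 ≤ k := by
    intro k hk j' hj' h
    rcases Finset.mem_union.1 h with h | h
    · obtain ⟨l, hl, e⟩ := Finset.mem_image.1 h
      have := hpinj l (by simp only [Finset.mem_Icc] at *; omega) k hk e
      simp only [Finset.mem_Icc] at *
      omega
    · obtain ⟨l, hl, e⟩ := Finset.mem_image.1 h
      exact absurd e.symm (hpa k hk l (by simp only [Finset.mem_Icc] at *; omega))
  have key : ∀ j ∈ Finset.Icc 1 3, ∀ x y z : ℕ, x ≠ y → x ≠ z → y ≠ z →
      ({x, y, z} : Finset ℕ) ⊆
        (Finset.Icc (j + 1) 4).image (φ i) ∪ (Finset.Icc 1 j).image (a i) →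
      a i j ∈ ({x, y, z} : Finset ℕ) →
      (∀ j' ∈ Finset.Icc 1 3, ({x, y, z} : Finset ℕ) ⊆
        (Finset.Icc (j' + 1) 4).image (φ i) ∪ (Finset.Icc 1 j').image (a i) → j' ≤ j) →
      x ∈ T ∨ y ∈ T ∨ z ∈ T := by
    intro j hj x y z hxy hxz hyz hsub haf hmax
    have hex : (Finset.Icc (j + 1) 4).image (φ i) ∪ (Finset.Icc 1 j).image (a i)
        ∈ Set.range σ := by
      rw [hrange]
      exact Or.inr ⟨i, hi, j, hj, rfl⟩
    obtain ⟨n, hn⟩ := hex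
    have hf : ({x, y, z} : Finset ℕ) ∈ sphereFacets 2 10 σ := by
      refine ⟨Finset.card_eq_three.2 ⟨x, y, z, hxy, hxz, hyz, rfl⟩, n, ?_, ?_⟩
      · show _ ⊆ σ n
        rw [hn]; exact hsub
      · intro m hm
        have hm : _ ⊆ σ m := hm
        apply hinj
        have hr : σ m ∈ Set.range σ := ⟨m, rfl⟩
        rw [hrange] at hr
        rcases hr with hr | ⟨i', hi', j', hj', hr⟩
        · have hr : σ m = Finset.Icc 1 4 := hr
          exact absurd (hr ▸ hm haf) (ha_new i hi j hj)
        · rw [hr] at hm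
          obtain ⟨h1, h2⟩ := hmema j hj i' hi' j' hj' (hm haf)
          subst h1
          have := hmax j' hj' hm
          have : j' = j := by omega
          subst this
          rw [hr, hn]
    obtain ⟨v, hv⟩ := hT _ hf
    simp only [Finset.mem_inter, Finset.mem_insert, Finset.mem_singleton] at hv
    rcases hv with ⟨hv, rfl | rfl | rfl⟩ <;> simp [hv]
  have ine : ∀ j ∈ Finset.Icc 1 3, ∀ k ∈ Finset.Icc 1 3, j ≠ k → a i j ≠ a i k :=
    fun j hj k hk h e => h (ha_inj i hi j hj i hi k hk e).2
  have i12 := ine 1 (by simp) 2 (by simp) (by simp)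
  have i13 := ine 1 (by simp) 3 (by simp) (by simp)
  have i23 := ine 2 (by simp) 3 (by simp) (by simp)
  have ma : ∀ j k, 1 ≤ k → k ≤ j →
      a i k ∈ (Finset.Icc (j + 1) 4).image (φ i) ∪ (Finset.Icc 1 j).image (a i) :=
    fun j k h1 h2 => Finset.mem_union_right _
      (Finset.mem_image_of_mem _ (Finset.mem_Icc.2 ⟨h1, h2⟩))
  have mp : ∀ j k, j + 1 ≤ k → k ≤ 4 →
      φ i k ∈ (Finset.Icc (j + 1) 4).image (φ i) ∪ (Finset.Icc 1 j).image (a i) :=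
    fun j k h1 h2 => Finset.mem_union_left _
      (Finset.mem_image_of_mem _ (Finset.mem_Icc.2 ⟨h1, h2⟩))
  have sub3 : ∀ (x y z : ℕ) (s : Finset ℕ), x ∈ s → y ∈ s → z ∈ s →
      ({x, y, z} : Finset ℕ) ⊆ s := by
    intro x y z s hx hy hz v hv
    simp only [Finset.mem_insert, Finset.mem_singleton] at hv
    rcases hv with rfl | rfl | rfl <;> assumption
  have F1 := key 3 (by simp) (a i 1) (a i 2) (a i 3) i12 i13 i23
    (sub3 _ _ _ _ (ma 3 1 (by simp) (by simp)) (ma 3 2 (by simp) (by simp))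
      (ma 3 3 (by simp) (by simp))) (by simp)
    (fun j' hj' _ => (Finset.mem_Icc.1 hj').2)
  have F2 := key 3 (by simp) (φ i 4) (a i 1) (a i 3) (hpa 4 (by simp) 1 (by simp))
    (hpa 4 (by simp) 3 (by simp)) i13
    (sub3 _ _ _ _ (mp 3 4 (by simp) (by simp)) (ma 3 1 (by simp) (by simp))
      (ma 3 3 (by simp) (by simp))) (by simp)
    (fun j' hj' _ => (Finset.mem_Icc.1 hj').2)
  have F3 := key 3 (by simp) (φ i 4) (a i 2) (a i 3) (hpa 4 (by simp) 2 (by simp))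
    (hpa 4 (by simp) 3 (by simp)) i23
    (sub3 _ _ _ _ (mp 3 4 (by simp) (by simp)) (ma 3 2 (by simp) (by simp))
      (ma 3 3 (by simp) (by simp))) (by simp)
    (fun j' hj' _ => (Finset.mem_Icc.1 hj').2)
  have F4 := key 1 (by simp) (φ i 2) (φ i 4) (a i 1)
    (fun h => absurd (hpinj 2 (by simp) 4 (by simp) h) (by simp))
    (hpa 2 (by simp) 1 (by simp)) (hpa 4 (by simp) 1 (by simp))
    (sub3 _ _ _ _ (mp 1 2 (by simp) (by simp)) (mp 1 4 (by simp) (by simp))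
      (ma 1 1 (by simp) (by simp))) (by simp)
    (fun j' hj' h => by
      have := hmemp 2 (by simp) j' hj' (h (by simp))
      omega)
  have F5 := key 2 (by simp) (φ i 3) (a i 1) (a i 2)
    (hpa 3 (by simp) 1 (by simp)) (hpa 3 (by simp) 2 (by simp)) i12
    (sub3 _ _ _ _ (mp 2 3 (by simp) (by simp)) (ma 2 1 (by simp) (by simp))
      (ma 2 2 (by simp) (by simp))) (by simp)
    (fun j' hj' h => by
      have := hmemp 3 (by simp) j' hj' (h (by simp))
      omega)
  constructor
  · apply Finset.card_pos.2
    rcases F1 with h | h | h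
    · exact ⟨a i 1, by simp [h]⟩
    · exact ⟨a i 2, by simp [h]⟩
    · exact ⟨a i 3, by simp [h]⟩
  · intro hc
    have huniq := Finset.card_le_one.1 hc.le
    have n12 : ¬ (a i 1 ∈ T ∧ a i 2 ∈ T) := fun h =>
      i12 (huniq _ (by simp [h.1]) _ (by simp [h.2]))
    have n13 : ¬ (a i 1 ∈ T ∧ a i 3 ∈ T) := fun h =>
      i13 (huniq _ (by simp [h.1]) _ (by simp [h.2]))
    have n23 : ¬ (a i 2 ∈ T ∧ a i 3 ∈ T) := fun h =>
      i23 (huniq _ (by simp [h.1]) _ (by simp [h.2]))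
    clear * - F1 F2 F3 F4 F5 n12 n13 n23
    tauto
end

section
/- Let V = {1,2,3,4} ⊔ {a^{(i)}_j : i ∈ [3], j ∈ [3]} (13 distinct vertices). Take the permutations φ₁ = (1,2,3,4), φ₂ = (4,1,2,3), φ₃ = (3,4,2,1) of [4] (written as the value sequence φ(1),φ(2),φ(3),φ(4)), and define τ^{(i)}_j = {φ_i(j+1), …, φ_i(4), a^{(i)}_1, …, a^{(i)}_j} for i, j ∈ [3]. The 3-simplices on {1,2,3,4} together with all τ^{(i)}_j form a well-defined stacked 3-ball B; let S₂ = ∂B, a stacked 2-sphere on 13 vertices. Let f = {1, 3, 4}; then f is a facet of S₂, and every transversal of the hypergraph of facets of S₂ other than f has size at least 6, i.e. τ(S₂ − {f}) ≥ 6. -/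
open Finset

/-- The permutations `φ₁ = (1,2,3,4)`, `φ₂ = (4,1,2,3)`, `φ₃ = (3,4,2,1)` of `[4]`
(written as the value sequences `φ(1), φ(2), φ(3), φ(4)`). -/
def phi13 : ℕ → ℕ → ℕ := fun i j =>
  if i = 1 then j
  else if i = 2 then (if j = 1 then 4 else j - 1)
  else if j = 1 then 3 else if j = 2 then 4 else if j = 3 then 2 else 1

/-- `τ⁽ⁱ⁾_j = {φ i (j+1), …, φ i 4, a i 1, …, a i j}`. -/
def tauSet13 (a : ℕ → ℕ → ℕ) (i j : ℕ) : Finset ℕ :=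
  (Finset.Icc (j + 1) 4).image (phi13 i) ∪ (Finset.Icc 1 j).image (a i)

/-- Combinatorial model of the simplices; `0,1,2,3` stand for `1,2,3,4` and `4+3i+j` for the `a`s. -/
def sig0 : Fin 10 → Finset (Fin 13) :=
  ![{0,1,2,3}, {1,2,3,4}, {2,3,4,5}, {3,4,5,6}, {0,1,2,7}, {1,2,7,8}, {2,7,8,9},
    {3,1,0,10}, {1,0,10,11}, {0,10,11,12}]

def eta0 : Fin 10 → Finset (Fin 13) :=
  ![∅, {1,2,3}, {2,3,4}, {3,4,5}, {0,1,2}, {1,2,7}, {2,7,8},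
    {3,1,0}, {1,0,10}, {0,10,11}]

def par0 : Fin 10 → Fin 10 := ![0,0,1,2,0,4,5,0,7,8]

def vert (a : ℕ → ℕ → ℕ) : Fin 13 → ℕ :=
  ![1,2,3,4,a 1 1,a 1 2,a 1 3,a 2 1,a 2 2,a 2 3,a 3 1,a 3 2,a 3 3]

def facets0 : List (Finset (Fin 13)) :=
  [{1,2,4},{1,3,4},{2,3,5},{2,4,5},{3,4,6},{3,5,6},{4,5,6},
   {0,1,7},{0,2,7},{1,2,8},{1,7,8},{2,7,9},{2,8,9},{7,8,9},
   {3,1,10},{3,0,10},{1,0,11},{1,10,11},{0,10,12},{0,11,12},{10,11,12}]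

lemma facets0_ok : ∀ f ∈ facets0, f ≠ {0,2,3} ∧ f.card = 3 ∧ ∃ i : Fin 10, f ⊆ sig0 i ∧
    ∀ j : Fin 10, f ⊆ sig0 j → j = i := by
  intro f hf
  simp only [facets0, List.mem_cons, List.not_mem_nil, or_false] at hf
  rcases hf with rfl | rfl | rfl | rfl | rfl | rfl | rfl | rfl | rfl | rfl | rfl | rfl | rfl | rfl | rfl | rfl | rfl | rfl | rfl | rfl | rfl <;>
    decide +kernel

lemma eta0_ok : ∀ k : Fin 10, 0 < k.val → (eta0 k).card = 3 ∧ eta0 k ⊆ sig0 k ∧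
    ((par0 k).val < k.val ∧ eta0 k ⊆ sig0 (par0 k) ∧
      ∀ j : Fin 10, j.val < k.val ∧ eta0 k ⊆ sig0 j → j = par0 k) ∧
    ∀ j : Fin 10, j.val < k.val → sig0 j ∩ sig0 k ⊆ eta0 k := by
  decide +kernel

lemma vert_inj (a : ℕ → ℕ → ℕ)
    (ha_inj : ∀ i ∈ Finset.Icc 1 3, ∀ j ∈ Finset.Icc 1 3,
      ∀ i' ∈ Finset.Icc 1 3, ∀ j' ∈ Finset.Icc 1 3,
      a i j = a i' j' → i = i' ∧ j = j')
    (ha_new : ∀ i ∈ Finset.Icc 1 3, ∀ j ∈ Finset.Icc 1 3,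
      a i j ∉ Finset.Icc 1 4) : Function.Injective (vert a) := by
  have hv : ∀ x : Fin 13, (x.val < 4 ∧ vert a x = x.val + 1) ∨
      (4 ≤ x.val ∧ vert a x = a ((x.val - 4) / 3 + 1) ((x.val - 4) % 3 + 1)) := by
    intro x; fin_cases x <;> simp [vert]
  intro x y h
  apply Fin.ext
  have hx' := x.2
  have hy' := y.2
  rcases hv x with ⟨hx, ex⟩ | ⟨hx, ex⟩ <;> rcases hv y with ⟨hy, ey⟩ | ⟨hy, ey⟩ <;> rw [ex, ey] at h
  · omega
  · exfalso
    apply ha_new ((y.val - 4) / 3 + 1) (by rw [Finset.mem_Icc]; omega)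
      ((y.val - 4) % 3 + 1) (by rw [Finset.mem_Icc]; omega)
    rw [← h, Finset.mem_Icc]; omega
  · exfalso
    apply ha_new ((x.val - 4) / 3 + 1) (by rw [Finset.mem_Icc]; omega)
      ((x.val - 4) % 3 + 1) (by rw [Finset.mem_Icc]; omega)
    rw [h, Finset.mem_Icc]; omega
  · have := ha_inj ((x.val - 4) / 3 + 1) (by rw [Finset.mem_Icc]; omega)
      ((x.val - 4) % 3 + 1) (by rw [Finset.mem_Icc]; omega)
      ((y.val - 4) / 3 + 1) (by rw [Finset.mem_Icc]; omega)
      ((y.val - 4) % 3 + 1) (by rw [Finset.mem_Icc]; omega) h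
    omega

lemma trans_num (x : Fin 13 → ℕ) (h1 : ∀ i, x i ≤ 1)
    (h : ∀ f ∈ facets0, 1 ≤ ∑ i ∈ f, x i) : 6 ≤ ∑ i, x i := by
  have H : ∀ p q r : Fin 13, p ≠ q → p ≠ r → q ≠ r → ({p,q,r} : Finset (Fin 13)) ∈ facets0 →
      1 ≤ x p + x q + x r := by
    intro p q r h1 h2 h3 hm
    have := h _ hm
    rw [Finset.sum_insert (by simp [h1, h2]), Finset.sum_pair h3] at this
    omega
  have f0 := H 1 2 4 (by decide) (by decide) (by decide) (by decide)
  have f1 := H 1 3 4 (by decide) (by decide) (by decide) (by decide)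
  have f2 := H 2 3 5 (by decide) (by decide) (by decide) (by decide)
  have f3 := H 2 4 5 (by decide) (by decide) (by decide) (by decide)
  have f4 := H 3 4 6 (by decide) (by decide) (by decide) (by decide)
  have f5 := H 3 5 6 (by decide) (by decide) (by decide) (by decide)
  have f6 := H 4 5 6 (by decide) (by decide) (by decide) (by decide)
  have f7 := H 0 1 7 (by decide) (by decide) (by decide) (by decide)
  have f8 := H 0 2 7 (by decide) (by decide) (by decide) (by decide)
  have f9 := H 1 2 8 (by decide) (by decide) (by decide) (by decide)
  have f10 := H 1 7 8 (by decide) (by decide) (by decide) (by decide)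
  have f11 := H 2 7 9 (by decide) (by decide) (by decide) (by decide)
  have f12 := H 2 8 9 (by decide) (by decide) (by decide) (by decide)
  have f13 := H 7 8 9 (by decide) (by decide) (by decide) (by decide)
  have f14 := H 3 1 10 (by decide) (by decide) (by decide) (by decide)
  have f15 := H 3 0 10 (by decide) (by decide) (by decide) (by decide)
  have f16 := H 1 0 11 (by decide) (by decide) (by decide) (by decide)
  have f17 := H 1 10 11 (by decide) (by decide) (by decide) (by decide)
  have f18 := H 0 10 12 (by decide) (by decide) (by decide) (by decide)
  have f19 := H 0 11 12 (by decide) (by decide) (by decide) (by decide)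
  have f20 := H 10 11 12 (by decide) (by decide) (by decide) (by decide)
  simp only [Fin.sum_univ_succ, Fin.sum_univ_zero]
  have b0 := h1 0
  have b1 := h1 1
  have b2 := h1 2
  have b3 := h1 3
  simp only [Fin.reduceSucc, Fin.succ_zero_eq_one, Fin.succ_one_eq_two, Fin.isValue] at *
  generalize x 0 = x0 at *
  generalize x 1 = x1 at *
  generalize x 2 = x2 at *
  generalize x 3 = x3 at *
  clear H h h1
  interval_cases x0 <;> interval_cases x1 <;> interval_cases x2 <;> interval_cases x3 <;> omega

/-- **Claim in the proof of the `13`-vertex lower bound.** With vertex set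
`{1,2,3,4} ⊔ {a i j : i ∈ [3], j ∈ [3]}` and the permutations `φ₁ = (1,2,3,4)`,
`φ₂ = (4,1,2,3)`, `φ₃ = (3,4,2,1)` of `[4]`, the simplex `{1,2,3,4}` together with
all `τ⁽ⁱ⁾_j` (`i, j ∈ [3]`) form a well-defined stacked `3`-ball whose boundary
`S₂` is a stacked `2`-sphere on `13` vertices, `f = {1,3,4}` is a facet of `S₂`,
and `τ(S₂ − {f}) ≥ 6`. -/
theorem explicit_13_vertex_construction (a : ℕ → ℕ → ℕ)
    (ha_inj : ∀ i ∈ Finset.Icc 1 3, ∀ j ∈ Finset.Icc 1 3,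
      ∀ i' ∈ Finset.Icc 1 3, ∀ j' ∈ Finset.Icc 1 3,
      a i j = a i' j' → i = i' ∧ j = j')
    (ha_new : ∀ i ∈ Finset.Icc 1 3, ∀ j ∈ Finset.Icc 1 3,
      a i j ∉ Finset.Icc 1 4) :
    ∃ σ : Fin 10 → Finset ℕ,
      IsStackedBall 2 10 σ ∧
      Set.range σ =
        ({Finset.Icc 1 4} : Set (Finset ℕ)) ∪
        {s | ∃ i ∈ Finset.Icc 1 3, ∃ j ∈ Finset.Icc 1 3, s = tauSet13 a i j} ∧
      (vertexSet 10 σ).card = 13 ∧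
      ({1, 3, 4} : Finset ℕ) ∈ sphereFacets 2 10 σ ∧
      6 ≤ tau (sphereFacets 2 10 σ \ ({({1, 3, 4} : Finset ℕ)} : Set (Finset ℕ))) := by
  have hinj := vert_inj a ha_inj ha_new
  let e : Fin 13 ↪ ℕ := ⟨vert a, hinj⟩
  have hf : ({1, 3, 4} : Finset ℕ) = ({0, 2, 3} : Finset (Fin 13)).map e := by
    simp [e, vert]
  have hfac : ∀ f : Finset (Fin 13), (f.card = 3 ∧ ∃ i : Fin 10, f ⊆ sig0 i ∧
      ∀ j : Fin 10, f ⊆ sig0 j → j = i) →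
      f.map e ∈ sphereFacets 2 10 (fun k => (sig0 k).map e) := by
    rintro f ⟨hc, i, hi, hu⟩
    refine ⟨by simpa using hc, i, by simpa using hi, fun j hj => hu j (by simpa using hj)⟩
  refine ⟨fun k => (sig0 k).map e, ⟨?_, ?_⟩, ?_, ?_, ?_, ?_⟩
  · intro i
    rw [Finset.card_map]
    revert i; decide
  · intro k hk
    obtain ⟨h1, h2, ⟨h3, h4, h5⟩, h6⟩ := eta0_ok k hk
    refine ⟨(eta0 k).map e, by simpa using h1, by simpa using h2,
      ⟨par0 k, ⟨h3, by simpa using h4⟩, fun j hj => h5 j ⟨hj.1, by simpa using hj.2⟩⟩, ?_⟩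
    intro t ht
    constructor
    · rintro ⟨j, hj, hjt⟩
      have := Finset.subset_inter hjt ht
      rw [← Finset.map_inter] at this
      exact this.trans (Finset.map_subset_map.2 (h6 j hj))
    · intro h
      exact ⟨par0 k, h3, h.trans (Finset.map_subset_map.2 h4)⟩
  · have hs : ∀ k : Fin 10, (sig0 k).map e = if k = 0 then Finset.Icc 1 4 else
        tauSet13 a ((k.val - 1) / 3 + 1) ((k.val - 1) % 3 + 1) := by
      have i14 : Finset.Icc 1 4 = ({1,2,3,4} : Finset ℕ) := by decide
      have i24 : Finset.Icc 2 4 = ({2,3,4} : Finset ℕ) := by decide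
      have i34 : Finset.Icc 3 4 = ({3,4} : Finset ℕ) := by decide
      have i12 : Finset.Icc 1 2 = ({1,2} : Finset ℕ) := by decide
      have i13 : Finset.Icc 1 3 = ({1,2,3} : Finset ℕ) := by decide
      intro k
      ext z
      fin_cases k <;> simp [sig0, e, vert, tauSet13, phi13, i14, i24, i34, i12, i13] <;> tauto
    ext s
    simp only [Set.mem_range, Set.mem_union, Set.mem_singleton_iff, Set.mem_ofPred_eq, hs]
    constructor
    · rintro ⟨k, rfl⟩
      by_cases hk : k = 0
      · simp [hk]
      · right
        have := k.2
        refine ⟨(k.val - 1) / 3 + 1, ?_, (k.val - 1) % 3 + 1, ?_, by simp [hk]⟩ <;>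
          rw [Finset.mem_Icc] <;> omega
    · rintro (rfl | ⟨i, hi, j, hj, rfl⟩)
      · exact ⟨0, by simp⟩
      · rw [Finset.mem_Icc] at hi hj
        refine ⟨⟨3 * (i - 1) + j, by omega⟩, ?_⟩
        rw [if_neg (by rw [Fin.ext_iff]; simp; omega)]
        congr 1
        · simp only []; omega
        · simp only []; omega
  · have : vertexSet 10 (fun k => (sig0 k).map e) = (Finset.univ : Finset (Fin 13)).map e := by
      ext z
      simp only [vertexSet, Finset.mem_biUnion, Finset.mem_map, Finset.mem_univ, true_and]
      constructor
      · rintro ⟨k, x, hx, rfl⟩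
        exact ⟨x, rfl⟩
      · rintro ⟨x, rfl⟩
        have : ∀ x : Fin 13, ∃ k, x ∈ sig0 k := by decide
        obtain ⟨k, hk⟩ := this x
        exact ⟨k, x, hk, rfl⟩
    rw [this, Finset.card_map]; simp
  · rw [hf]
    exact hfac _ (by decide +kernel)
  · have key : ∀ T : Finset ℕ, IsTransversal T
        (sphereFacets 2 10 (fun k => (sig0 k).map e) \ {({1, 3, 4} : Finset ℕ)}) →
        6 ≤ T.card := by
      intro T hT
      have h1 := trans_num (fun i => if e i ∈ T then 1 else 0)
        (fun i => by split_ifs <;> simp) (by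
          intro f hfm
          obtain ⟨g1, g2⟩ := facets0_ok f hfm
          have hm := hT (f.map e) ⟨hfac f g2, by
            rw [Set.mem_singleton_iff, hf]
            exact fun h => g1 (Finset.map_injective e h)⟩
          obtain ⟨z, hz⟩ := hm
          rw [Finset.mem_inter, Finset.mem_map] at hz
          obtain ⟨hzT, x, hx, rfl⟩ := hz
          have := Finset.single_le_sum (f := fun i => if e i ∈ T then 1 else 0)
            (fun i _ => Nat.zero_le _) hx
          simpa [hzT] using this)
      rw [← Finset.card_filter] at h1
      refine h1.trans ?_
      rw [← Finset.card_map e]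
      apply Finset.card_le_card
      intro z hz
      simp only [Finset.mem_map, Finset.mem_filter] at hz
      obtain ⟨x, ⟨_, hx⟩, rfl⟩ := hz
      exact hx
    have hne : {n | ∃ T : Finset ℕ, T.card = n ∧ IsTransversal T
        (sphereFacets 2 10 (fun k => (sig0 k).map e) \ {({1, 3, 4} : Finset ℕ)})}.Nonempty := by
      refine ⟨_, (Finset.univ : Finset (Fin 13)).map e, rfl, ?_⟩
      rintro f ⟨⟨hc, i, hi, -⟩, -⟩
      have hne : f.Nonempty := Finset.card_pos.1 (by omega)
      obtain ⟨z, hz⟩ := hne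
      exact ⟨z, Finset.mem_inter.2
        ⟨Finset.map_subset_map.2 (Finset.subset_univ _) (hi hz), hz⟩⟩
    obtain ⟨T, hc, hT⟩ := Nat.sInf_mem hne
    unfold tau
    rw [← hc]
    exact key T hT
end
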